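/- arXiv:1005.1267 — 3 statements merged into one kernel-verified Lean document; each statement's English description precedes it below -/
import Mathlib

section
/- Let H be a finite-dimensional non-semisimple Hopf algebra over an algebraically closed field k of characteristic zero with Jacobson radical J. For any simple H-modules V, W, the multiplicity [J·P(V)/J²·P(V) : W] equals dim Ext¹_H(V, W), which also equals [Soc(I(W)/W) : V]. Moreover, if the dual H* has no non-trivial skew primitive element, then no simple H-submodule of J·P(k)/J²·P(k) or of Soc(I(k)/k) is 1-dimensional, where k denotes the trivial 1-dimensional H-module. -/
open scoped TensorProduct

/-- An element of a coalgebra (with comultiplication `Δ`) is group-like if it is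
nonzero and `Δ a = a ⊗ a`. -/
def IsGroupLikeOf {k H : Type} [CommRing k] [AddCommGroup H] [Module k H]
    (Δ : H →ₗ[k] H ⊗[k] H) (a : H) : Prop :=
  a ≠ 0 ∧ Δ a = a ⊗ₜ[k] a

/-- A `k`-subspace `C` of a coalgebra with comultiplication `Δ` is a subcoalgebra if
`Δ C ⊆ C ⊗ C`. -/
def IsSubcoalgebraOf {k H : Type} [CommRing k] [AddCommGroup H] [Module k H]
    (Δ : H →ₗ[k] H ⊗[k] H) (C : Submodule k H) : Prop :=
  ∀ c ∈ C, Δ c ∈ LinearMap.range (TensorProduct.map C.subtype C.subtype)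

/-- A subcoalgebra is simple if it is nonzero and has no proper nonzero subcoalgebras. -/
def IsSimpleSubcoalgebraOf {k H : Type} [CommRing k] [AddCommGroup H] [Module k H]
    (Δ : H →ₗ[k] H ⊗[k] H) (C : Submodule k H) : Prop :=
  IsSubcoalgebraOf Δ C ∧ C ≠ ⊥ ∧
    ∀ D : Submodule k H, IsSubcoalgebraOf Δ D → D ≤ C → D = ⊥ ∨ D = C

/-- A coalgebra is pointed if every simple subcoalgebra is one-dimensional. -/
def IsPointedOf {k H : Type} [CommRing k] [AddCommGroup H] [Module k H]
    (Δ : H →ₗ[k] H ⊗[k] H) : Prop :=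
  ∀ C : Submodule k H, IsSimpleSubcoalgebraOf Δ C → Module.finrank k C = 1

/-- A linear functional on `H` (with multiplication `m` and unit `u`) is a group-like element
of the dual Hopf algebra `H*` precisely when it is an algebra character. -/
def IsDualGroupLikeOf {k H : Type} [CommRing k] [AddCommGroup H] [Module k H]
    (m : H →ₗ[k] H →ₗ[k] H) (u : H) (φ : Module.Dual k H) : Prop :=
  φ u = 1 ∧ ∀ a b : H, φ (m a b) = φ a * φ b

/-- A subspace `C` of `H* = Dual k H` is a subcoalgebra of the dual Hopf algebra iff the dual
comultiplication (dual to the multiplication `m` of `H`) of every `f ∈ C` lies in `C ⊗ C`,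
i.e. `f ∘ m` decomposes as a finite sum `∑ uᵢ ⊗ vᵢ` with `uᵢ, vᵢ ∈ C`. -/
def IsDualSubcoalgebraOf {k H : Type} [CommRing k] [AddCommGroup H] [Module k H]
    (m : H →ₗ[k] H →ₗ[k] H) (C : Submodule k (Module.Dual k H)) : Prop :=
  ∀ f ∈ C, ∃ (n : ℕ) (u v : Fin n → Module.Dual k H),
    (∀ i, u i ∈ C ∧ v i ∈ C) ∧ ∀ a b : H, f (m a b) = ∑ i, u i a * v i b

/-- A simple subcoalgebra of the dual Hopf algebra. -/
def IsDualSimpleSubcoalgebraOf {k H : Type} [CommRing k] [AddCommGroup H] [Module k H]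
    (m : H →ₗ[k] H →ₗ[k] H) (C : Submodule k (Module.Dual k H)) : Prop :=
  IsDualSubcoalgebraOf m C ∧ C ≠ ⊥ ∧
    ∀ D : Submodule k (Module.Dual k H), IsDualSubcoalgebraOf m D → D ≤ C → D = ⊥ ∨ D = C

/-- The dual Hopf algebra `H*` is pointed iff all its simple subcoalgebras are
one-dimensional. -/
def IsDualPointedOf {k H : Type} [CommRing k] [AddCommGroup H] [Module k H]
    (m : H →ₗ[k] H →ₗ[k] H) : Prop :=
  ∀ C : Submodule k (Module.Dual k H), IsDualSimpleSubcoalgebraOf m C → Module.finrank k C = 1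

/-- `H` (with comultiplication `Δ`) has a non-trivial skew primitive element:  an element `y`
with `Δ y = y ⊗ g + h ⊗ y` for group-likes `g, h`, which does not lie in the linear span of the
group-like elements. -/
def HasNontrivialSkewPrimitiveOf {k H : Type} [CommRing k] [AddCommGroup H] [Module k H]
    (Δ : H →ₗ[k] H ⊗[k] H) : Prop :=
  ∃ y g h : H, IsGroupLikeOf Δ g ∧ IsGroupLikeOf Δ h ∧
    Δ y = y ⊗ₜ[k] g + h ⊗ₜ[k] y ∧ y ∉ Submodule.span k {a : H | IsGroupLikeOf Δ a}

/-- The dual Hopf algebra `H*` has a non-trivial skew primitive element:  a functional `f`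
which is `(g,h)`-skew primitive for algebra characters `g, h` (the group-likes of `H*`), and
does not lie in the linear span of the characters.  (The comultiplication of `H*` is dual to
the multiplication `m` of `H`, with unit `u`.) -/
def DualHasNontrivialSkewPrimitiveOf {k H : Type} [CommRing k] [AddCommGroup H] [Module k H]
    (m : H →ₗ[k] H →ₗ[k] H) (u : H) : Prop :=
  ∃ f g h : Module.Dual k H, IsDualGroupLikeOf m u g ∧ IsDualGroupLikeOf m u h ∧
    (∀ a b : H, f (m a b) = f a * g b + h a * f b) ∧
    f ∉ Submodule.span k {φ : Module.Dual k H | IsDualGroupLikeOf m u φ}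

/-- `π : P →ₗ[H] V` exhibits `P` as a projective cover of the `H`-module `V`:  `P` is
projective, `π` is surjective, and `ker π` is superfluous in `P`. -/
def IsProjectiveCoverOf {H P V : Type} [Ring H] [AddCommGroup P] [Module H P]
    [AddCommGroup V] [Module H V] (π : P →ₗ[H] V) : Prop :=
  Module.Projective H P ∧ Function.Surjective π ∧
    ∀ N : Submodule H P, N ⊔ LinearMap.ker π = ⊤ → N = ⊤

/-- The trivial `H`-module structure on `k`, given by the counit of the bialgebra `H`. -/
noncomputable def trivialModuleOfCounit (k H : Type) [CommSemiring k] [Semiring H]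
    [Bialgebra k H] : Module H k :=
  Module.compHom k (Bialgebra.counitAlgHom k H).toRingHom

attribute [local instance] trivialModuleOfCounit

/-- The socle of a module: the sum of all its simple submodules. -/
def moduleSocle (H M : Type) [Ring H] [AddCommGroup M] [Module H M] : Submodule H M :=
  sSup {N : Submodule H M | IsSimpleModule H N}

open CategoryTheory in
/-- Dimension shifting on both sides at once. -/
theorem exists_dimension_shift {k C : Type*} [Field k] [Category* C] [Abelian C] [Linear k C]
    {A₂ A₁ A₀ V W I Q : C} (a : A₂ ⟶ A₁) (b : A₁ ⟶ A₀) (π : A₀ ⟶ V) (ι : W ⟶ I) (q : I ⟶ Q)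
    (hab : a ≫ b = 0) (hbπ : b ≫ π = 0) (hιq : ι ≫ q = 0)
    (exab : (ShortComplex.mk a b hab).Exact) (exbπ : (ShortComplex.mk b π hbπ).Exact)
    (exιq : (ShortComplex.mk ι q hιq).Exact)
    [Epi π] [Mono ι] [Epi q] [Projective A₀] [Injective I]
    (hVI : ∀ t : V ⟶ I, t ≫ q = 0) :
    ∃ (X : Submodule k ((A₀ ⟶ I) × (A₁ ⟶ W) × (V ⟶ Q)))
      (u : X →ₗ[k] (A₁ ⟶ W)) (g : X →ₗ[k] (V ⟶ Q)), Function.Surjective g ∧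
      (∀ x, a ≫ u x = 0) ∧ (∀ z, a ≫ z = 0 → ∃ x, u x = z) ∧
      ∀ x, g x = 0 ↔ ∃ y : A₀ ⟶ W, b ≫ y = u x := by
  refine ⟨{ carrier := {x | b ≫ x.1 = x.2.1 ≫ ι ∧ x.1 ≫ q = π ≫ x.2.2}
            add_mem' := fun {x y} hx hy ↦ by simp_all
            zero_mem' := by simp
            smul_mem' := fun c x hx ↦ by simp_all },
    LinearMap.fst k _ _ ∘ₗ LinearMap.snd k _ _ ∘ₗ Submodule.subtype _,
    LinearMap.snd k _ _ ∘ₗ LinearMap.snd k _ _ ∘ₗ Submodule.subtype _, ?_, ?_, ?_, ?_⟩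
  · intro g
    have hF : Projective.factorThru (π ≫ g) q ≫ q = π ≫ g := Projective.factorThru_comp _ _
    have hz := exιq.lift_f (b ≫ Projective.factorThru (π ≫ g) q)
      (by simp [hF, reassoc_of% hbπ])
    exact ⟨⟨(_, _, g), hz.symm, hF⟩, rfl⟩
  · rintro ⟨⟨F, z, g⟩, h₁, h₂⟩
    change a ≫ z = 0
    dsimp at h₁
    rw [← cancel_mono ι, Category.assoc, ← h₁, reassoc_of% hab, Limits.zero_comp,
      Limits.zero_comp]
  · intro z hz
    have hF := exab.comp_descToInjective (z ≫ ι) (by simp [reassoc_of% hz])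
    have hg := exbπ.g_desc (exab.descToInjective (z ≫ ι) (by simp [reassoc_of% hz]) ≫ q)
      (by rw [← Category.assoc]; erw [hF]; simp [hιq])
    exact ⟨⟨(_, z, _), hF, hg.symm⟩, rfl⟩
  · rintro ⟨⟨F, z, g⟩, h₁, h₂⟩
    change g = 0 ↔ ∃ y : A₀ ⟶ W, b ≫ y = z
    dsimp at h₁ h₂
    constructor
    · rintro rfl
      have hG := exιq.lift_f F (by simp [h₂])
      refine ⟨exιq.lift F (by simp [h₂]), ?_⟩
      rw [← cancel_mono ι, Category.assoc, ← h₁]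
      exact congrArg (b ≫ ·) hG
    · rintro ⟨y, rfl⟩
      have ht := exbπ.g_desc (F - y ≫ ι) (by simp [h₁])
      dsimp at ht
      rw [← cancel_epi π, ← h₂, ← sub_eq_zero, Limits.comp_zero, sub_zero]
      have : F ≫ q = (F - y ≫ ι) ≫ q := by simp [hιq]
      rw [this, ← ht, Category.assoc, hVI, Limits.comp_zero]

theorem finrank_eq_of_surjective_of_ker_eq {k X A B : Type*} [Field k] [AddCommGroup X]
    [Module k X] [AddCommGroup A] [Module k A] [AddCommGroup B] [Module k B] (f : X →ₗ[k] A)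
    (g : X →ₗ[k] B) (hf : Function.Surjective f) (hg : Function.Surjective g)
    (h : ∀ x, f x = 0 ↔ g x = 0) : Module.finrank k A = Module.finrank k B := by
  have hker : LinearMap.ker f = LinearMap.ker g := Submodule.ext h
  exact (((f.quotKerEquivOfSurjective hf).symm.trans (Submodule.quotEquivOfEq _ _ hker)).trans
    (g.quotKerEquivOfSurjective hg)).finrank_eq

open CategoryTheory in
theorem CategoryTheory.ShortComplex.finrank_homology_eq {k X B : Type} [Field k]
    (S : ShortComplex (ModuleCat.{0} k))
    [AddCommGroup X] [Module k X] [AddCommGroup B] [Module k B] (u : X →ₗ[k] S.X₂)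
    (g : X →ₗ[k] B) (hg : Function.Surjective g) (h₁ : ∀ x, S.g.hom (u x) = 0)
    (h₂ : ∀ z, S.g.hom z = 0 → ∃ x, u x = z)
    (h₃ : ∀ x, g x = 0 ↔ ∃ y, S.f.hom y = u x) :
    Module.finrank k S.homology = Module.finrank k B := by
  rw [(S.moduleCatHomologyIso.toLinearEquiv).finrank_eq]
  change Module.finrank k
    (LinearMap.ker S.g.hom ⧸ LinearMap.range S.moduleCatToCycles) = Module.finrank k B
  refine finrank_eq_of_surjective_of_ker_eq
    ((LinearMap.range S.moduleCatToCycles).mkQ ∘ₗ u.codRestrict (LinearMap.ker S.g.hom) h₁) g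
    ((Submodule.mkQ_surjective _).comp fun ⟨z, hz⟩ ↦ ?_) hg fun x ↦ ?_
  · obtain ⟨x, rfl⟩ := h₂ z hz
    exact ⟨x, rfl⟩
  · rw [h₃, LinearMap.comp_apply, Submodule.mkQ_apply, Submodule.Quotient.mk_eq_zero]
    exact ⟨fun ⟨y, hy⟩ ↦ ⟨y, congrArg Subtype.val hy⟩, fun ⟨y, hy⟩ ↦ ⟨y, Subtype.ext hy⟩⟩

open CategoryTheory in
theorem finrank_Ext_one_eq {k : Type} [Field k] {C : Type 1} [Category.{0} C] [Abelian C]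
    [Linear k C] [EnoughProjectives C] {V W I Q : C} (ι : W ⟶ I) (q : I ⟶ Q) (hιq : ι ≫ q = 0)
    (exιq : (ShortComplex.mk ι q hιq).Exact) [Mono ι] [Epi q] [Injective I]
    (hVI : ∀ t : V ⟶ I, t ≫ q = 0) :
    Module.finrank k (((Ext k C 1).obj (Opposite.op V)).obj W) = Module.finrank k (V ⟶ Q) := by
  let R := projectiveResolution V
  obtain ⟨X, u, g, hg, h₁, h₂, h₃⟩ := exists_dimension_shift (k := k) _ _ (R.π.f 0) ι q _ _ hιq
    (R.exact_succ 0) R.exact₀ exιq hVI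
  let K := R.complex.linearYonedaObj k W
  refine ((R.isoExt 1 W).toLinearEquiv).finrank_eq.trans ((ShortComplex.homologyMapIso
    (K.isoSc' 0 1 2 (by simp) (by simp))).toLinearEquiv.finrank_eq.trans ?_)
  exact (K.sc' 0 1 2).finrank_homology_eq u g hg h₁ h₂ h₃

open CategoryTheory in
theorem finrank_kernel_hom_eq {k C : Type*} [Field k] [Category* C] [Abelian C] [Linear k C]
    {K P V W I Q : C} (j : K ⟶ P) (π : P ⟶ V) (hjπ : j ≫ π = 0)
    (exjπ : (ShortComplex.mk j π hjπ).Exact) [Mono j] [Epi π] [Projective P]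
    (ι : W ⟶ I) (q : I ⟶ Q) (hιq : ι ≫ q = 0)
    (exιq : (ShortComplex.mk ι q hιq).Exact) [Mono ι] [Epi q] [Injective I]
    (hVI : ∀ t : V ⟶ I, t ≫ q = 0) (hPW : ∀ t : P ⟶ W, j ≫ t = 0) :
    Module.finrank k (K ⟶ W) = Module.finrank k (V ⟶ Q) := by
  obtain ⟨X, u, g, hg, h₁, h₂, h₃⟩ := exists_dimension_shift (k := k) (0 : K ⟶ K) j π ι q
    (by simp) hjπ hιq (((ShortComplex.mk (0 : K ⟶ K) j (by simp)).exact_iff_mono rfl).2 ‹_›)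
    exjπ exιq hVI
  refine finrank_eq_of_surjective_of_ker_eq u g (fun z ↦ h₂ z (by simp)) hg fun x ↦ ?_
  simp only [h₃, hPW, exists_const, eq_comm]

theorem finrank_hom_submodule_eq {k R V M : Type*} [Field k] [Ring R] [Algebra k R]
    [AddCommGroup V] [Module R V] [AddCommGroup M] [Module k M] [Module R M]
    [IsScalarTower k R M] (N : Submodule R M)
    (h : ∀ f : V →ₗ[R] M, LinearMap.range f ≤ N) :
    Module.finrank k (V →ₗ[R] N) = Module.finrank k (V →ₗ[R] M) := by
  let F : (V →ₗ[R] N) →ₗ[k] (V →ₗ[R] M) :=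
    { toFun f := N.subtype ∘ₗ f
      map_add' _ _ := rfl
      map_smul' _ _ := rfl }
  refine (LinearEquiv.ofBijective F ⟨fun f g hfg ↦ ?_, fun f ↦ ?_⟩).finrank_eq
  · ext v
    exact LinearMap.congr_fun hfg v
  · exact ⟨f.codRestrict N fun v ↦ h f ⟨v, rfl⟩, rfl⟩

theorem finrank_quotient_hom_eq {k R M W : Type*} [Field k] [Ring R] [Algebra k R]
    [AddCommGroup M] [Module R M] [AddCommGroup W] [Module k W] [Module R W]
    [IsScalarTower k R W] (N : Submodule R M)
    (h : ∀ f : M →ₗ[R] W, N ≤ LinearMap.ker f) :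
    Module.finrank k (M ⧸ N →ₗ[R] W) = Module.finrank k (M →ₗ[R] W) := by
  let F : (M ⧸ N →ₗ[R] W) →ₗ[k] (M →ₗ[R] W) :=
    { toFun f := f ∘ₗ N.mkQ
      map_add' _ _ := rfl
      map_smul' _ _ := rfl }
  refine (LinearEquiv.ofBijective F ⟨fun f g hfg ↦ ?_, fun f ↦ ?_⟩).finrank_eq
  · exact N.linearMap_qext hfg
  · exact ⟨N.liftQ f (h f), N.liftQ_mkQ f (h f)⟩

theorem range_le_isotypicComponent {R M S : Type*} [Ring R] [AddCommGroup M] [Module R M]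
    [AddCommGroup S] [Module R S] [IsSimpleModule R S] (f : S →ₗ[R] M) :
    LinearMap.range f ≤ isotypicComponent R M S := by
  obtain hf | rfl := f.injective_or_eq_zero
  · exact le_sSup ⟨(LinearEquiv.ofInjective f hf).symm⟩
  · simp

theorem finrank_hom_congr_right {k R S M N : Type*} [Field k] [Ring R] [Algebra k R]
    [AddCommGroup S] [Module R S]
    [AddCommGroup M] [Module k M] [Module R M] [IsScalarTower k R M]
    [AddCommGroup N] [Module k N] [Module R N] [IsScalarTower k R N] (e : M ≃ₗ[R] N) :
    Module.finrank k (S →ₗ[R] M) = Module.finrank k (S →ₗ[R] N) :=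
  LinearEquiv.finrank_eq
    { toFun f := e.toLinearMap ∘ₗ f
      map_add' _ _ := by ext; simp
      map_smul' c f := LinearMap.ext fun x ↦ e.toLinearMap.map_smul_of_tower c (f x)
      invFun f := e.symm.toLinearMap ∘ₗ f
      left_inv _ := by ext; simp
      right_inv _ := by ext; simp }

theorem finrank_finsupp_hom_eq {k R S α : Type*} [Field k] [Ring R] [Algebra k R]
    [AddCommGroup S] [Module k S] [Module R S] [IsScalarTower k R S] [Nontrivial S] :
    Module.finrank k (S →ₗ[R] α →₀ S) = Module.finrank k ((α →₀ S) →ₗ[R] S) := by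
  classical
  obtain hα | hα := finite_or_infinite α
  · have := Fintype.ofFinite α
    let e := Finsupp.linearEquivFunOnFinite R S α
    rw [finrank_hom_congr_right e, ((e.congrLeft S k)).finrank_eq]
    exact ((LinearEquiv.linearMapPi k).symm.trans
      (LinearMap.lsum R (fun _ : α ↦ S) k)).finrank_eq
  · obtain ⟨s, hs⟩ := exists_ne (0 : S)
    have h₁ : LinearIndependent k fun a : α ↦ (Finsupp.lsingle a : S →ₗ[R] α →₀ S) := by
      rw [linearIndependent_iff']
      intro t c hc a ha
      have := DFunLike.congr_fun (LinearMap.congr_fun hc s) a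
      simpa [Finsupp.single_apply, ha, hs] using this
    have h₂ : LinearIndependent k fun a : α ↦ (Finsupp.lapply a : (α →₀ S) →ₗ[R] S) := by
      rw [linearIndependent_iff']
      intro t c hc a ha
      have := LinearMap.congr_fun hc (Finsupp.single a s)
      simpa [Finsupp.single_apply, ha, hs] using this
    rw [Module.finrank_of_not_finite, Module.finrank_of_not_finite]
    · exact fun _ ↦ not_finite_iff_infinite.2 hα h₂.finite
    · exact fun _ ↦ not_finite_iff_infinite.2 hα h₁.finite

theorem finrank_hom_comm_of_isSemisimpleModule {k R S M : Type*} [Field k] [Ring R] [Algebra k R]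
    [AddCommGroup S] [Module k S] [Module R S] [IsScalarTower k R S] [IsSimpleModule R S]
    [AddCommGroup M] [Module k M] [Module R M] [IsScalarTower k R M] [IsSemisimpleModule R M] :
    Module.finrank k (S →ₗ[R] M) = Module.finrank k (M →ₗ[R] S) := by
  have := IsSimpleModule.nontrivial R S
  let N := isotypicComponent R M S
  rw [← finrank_hom_submodule_eq N range_le_isotypicComponent]
  let F : (M →ₗ[R] S) →ₗ[k] (N →ₗ[R] S) :=
    { toFun f := f ∘ₗ N.subtype
      map_add' _ _ := rfl
      map_smul' _ _ := rfl }
  have hF : Function.Bijective F := by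
    refine ⟨(injective_iff_map_eq_zero F).2 fun f hf ↦ ?_, fun f ↦ ?_⟩
    · obtain h | h := f.surjective_or_eq_zero
      · obtain ⟨g, hg⟩ := IsSemisimpleModule.lifting_property f h LinearMap.id
        obtain ⟨s, hs⟩ := exists_ne (0 : S)
        refine absurd ?_ hs
        have h₁ := LinearMap.congr_fun hg s
        have h₂ := LinearMap.congr_fun hf ⟨g s, range_le_isotypicComponent g ⟨s, rfl⟩⟩
        exact h₁.symm.trans h₂
      · exact h
    · obtain ⟨g, hg⟩ := IsSemisimpleModule.extension_property N.subtype N.injective_subtype f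
      exact ⟨g, hg⟩
  rw [(LinearEquiv.ofBijective F hF).finrank_eq]
  obtain ⟨α, ⟨e⟩⟩ := (IsIsotypicOfType.isotypicComponent R M S).linearEquiv_finsupp
  rw [finrank_hom_congr_right e, (e.congrLeft S k).finrank_eq, finrank_finsupp_hom_eq]

section Artinian

variable {R M N : Type*} [Ring R] [AddCommGroup M] [Module R M] [AddCommGroup N] [Module R N]

theorem smul_eq_zero_of_mem_jacobson_bot [IsSemisimpleModule R M] {r : R}
    (hr : r ∈ (⊥ : Ideal R).jacobson) (m : M) : r • m = 0 :=
  Module.mem_annihilator.1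
    (IsSemisimpleModule.jacobson_le_annihilator R M (Ideal.jacobson_bot.le hr)) m

theorem isSemisimpleModule_of_jacobson_bot_smul_eq_zero [IsArtinianRing R]
    (h : ∀ r ∈ (⊥ : Ideal R).jacobson, ∀ m : M, r • m = 0) : IsSemisimpleModule R M := by
  have h' : Module.IsTorsionBySet R M (Ring.jacobson R) :=
    fun m r ↦ h r.1 (Ideal.jacobson_bot.ge r.2) m
  let _ := h'.module
  exact (h'.semilinearMap.isSemisimpleModule_iff_of_bijective Function.bijective_id).2 inferInstance

theorem jacobson_bot_smul_top_le_ker [IsSemisimpleModule R N] (f : M →ₗ[R] N) :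
    (⊥ : Ideal R).jacobson • (⊤ : Submodule R M) ≤ LinearMap.ker f :=
  Submodule.smul_le.2 fun r hr m _ ↦ by
    rw [LinearMap.mem_ker, map_smul, smul_eq_zero_of_mem_jacobson_bot hr]

instance isSemisimpleModule_quotient_jacobson_bot_smul_top [IsArtinianRing R] :
    IsSemisimpleModule R (M ⧸ (⊥ : Ideal R).jacobson • (⊤ : Submodule R M)) :=
  isSemisimpleModule_of_jacobson_bot_smul_eq_zero fun r hr m ↦ by
    obtain ⟨m, rfl⟩ := Submodule.mkQ_surjective _ m
    rw [← map_smul, Submodule.mkQ_apply, Submodule.Quotient.mk_eq_zero]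
    exact Submodule.smul_mem_smul hr trivial

theorem le_jacobson_bot_smul_top_of_superfluous [IsArtinianRing R] {K : Submodule R M}
    (hK : ∀ L : Submodule R M, L ⊔ K = ⊤ → L = ⊤) :
    K ≤ (⊥ : Ideal R).jacobson • (⊤ : Submodule R M) := by
  set J := (⊥ : Ideal R).jacobson • (⊤ : Submodule R M) with hJ
  have : IsSemisimpleModule R (M ⧸ J) := inferInstance
  obtain ⟨C, hC⟩ := exists_isCompl (K.map J.mkQ)
  have h := hK (C.comap J.mkQ) <| by
    refine eq_top_iff.2 fun m _ ↦ ?_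
    obtain ⟨x, hx, y, hy, hxy⟩ := Submodule.mem_sup.1
      (hC.sup_eq_top.ge trivial : J.mkQ m ∈ K.map J.mkQ ⊔ C)
    obtain ⟨x, hx, rfl⟩ := hx
    refine Submodule.mem_sup.2 ⟨m - x, ?_, x, hx, by simp⟩
    rwa [Submodule.mem_comap, map_sub, ← hxy, add_sub_cancel_left]
  intro x hx
  rw [← J.ker_mkQ, LinearMap.mem_ker]
  have h₁ : x ∈ C.comap J.mkQ := h.ge trivial
  exact (Submodule.disjoint_def.1 hC.disjoint) _ ⟨x, hx, rfl⟩ h₁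

theorem le_of_isSemisimpleModule_of_essential {U L : Submodule R M}
    (hU : ∀ N : Submodule R M, N ⊓ U = ⊥ → N = ⊥) [IsSemisimpleModule R L] : L ≤ U := by
  obtain ⟨C, hC⟩ := exists_isCompl (U.comap L.subtype)
  have h : C = ⊥ := by
    refine Submodule.map_injective_of_injective L.injective_subtype
      (Eq.trans (hU _ ?_) (Submodule.map_bot _).symm)
    refine (Submodule.eq_bot_iff _).2 ?_
    rintro _ ⟨⟨c, hc, rfl⟩, hcU⟩
    rw [Submodule.disjoint_def.1 hC.disjoint c hcU hc, map_zero]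
  rw [h] at hC
  have h₁ := hC.sup_eq_top
  rw [sup_bot_eq] at h₁
  exact fun x hx ↦ (h₁.ge trivial : (⟨x, hx⟩ : L) ∈ U.comap L.subtype)

theorem isSemisimpleModule_sSup_isSimpleModule :
    IsSemisimpleModule R (sSup {N : Submodule R M | IsSimpleModule R N} : Submodule R M) := by
  rw [sSup_eq_iSup]
  exact isSemisimpleModule_biSup_of_isSemisimpleModule_submodule fun N hN ↦
    have : IsSimpleModule R N := hN
    inferInstance

theorem range_le_sSup_isSimpleModule [IsSimpleModule R N] (f : N →ₗ[R] M) :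
    LinearMap.range f ≤ sSup {N : Submodule R M | IsSimpleModule R N} := by
  obtain hf | rfl := f.injective_or_eq_zero
  · exact le_sSup (IsSimpleModule.congr (LinearEquiv.ofInjective f hf).symm)
  · simp

end Artinian

theorem IsDualGroupLikeOf.apply_eq_zero_of_mem_jacobson_bot {k H : Type} [Field k] [Ring H]
    [Algebra k H] {φ : Module.Dual k H} (hφ : IsDualGroupLikeOf (LinearMap.mul k H) 1 φ) {j : H}
    (hj : j ∈ (⊥ : Ideal H).jacobson) : φ j = 0 := by
  by_contra hne
  obtain ⟨z, hz⟩ := Ideal.mem_jacobson_iff.1 hj (algebraMap k H (-(φ j)⁻¹))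
  have hmul : ∀ a b, φ (a * b) = φ a * φ b := hφ.2
  have h := congrArg φ (Ideal.mem_bot.1 hz)
  rw [map_sub, map_add, hmul, hmul, Algebra.algebraMap_eq_smul_one, map_smul, hφ.1, map_zero] at h
  simp [hne] at h

theorem apply_eq_zero_of_not_dualHasNontrivialSkewPrimitiveOf {k H : Type} [Field k] [Ring H]
    [Algebra k H] (hH : ¬ DualHasNontrivialSkewPrimitiveOf (LinearMap.mul k H) 1)
    {f g h : Module.Dual k H} (hg : IsDualGroupLikeOf (LinearMap.mul k H) 1 g)
    (hh : IsDualGroupLikeOf (LinearMap.mul k H) 1 h)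
    (hf : ∀ a b : H, f (a * b) = f a * g b + h a * f b) {j : H}
    (hj : j ∈ (⊥ : Ideal H).jacobson) : f j = 0 := by
  have hspan : f ∈ Submodule.span k {φ : Module.Dual k H |
      IsDualGroupLikeOf (LinearMap.mul k H) 1 φ} := by
    by_contra hne
    exact hH ⟨f, g, h, hg, hh, hf, hne⟩
  clear hf
  induction hspan using Submodule.span_induction with
  | mem φ hφ => exact hφ.apply_eq_zero_of_mem_jacobson_bot hj
  | zero => rfl
  | add x y _ _ hx hy => simp_all
  | smul c x _ hx => simp_all

theorem exists_isDualGroupLikeOf_of_finrank_eq_one {k H N : Type} [Field k] [Ring H]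
    [Algebra k H] [AddCommGroup N] [Module k N] [Module H N] [IsScalarTower k H N]
    (hN : Module.finrank k N = 1) :
    ∃ (e : Module.Dual k N) (χ : Module.Dual k H), Function.Injective e ∧
      IsDualGroupLikeOf (LinearMap.mul k H) 1 χ ∧ ∀ (h : H) (n : N), h • n = χ h • n := by
  have := IsScalarTower.to_smulCommClass' (R := k) (A := H) (M := N)
  have := Module.finite_of_finrank_eq_succ hN
  let e : N ≃ₗ[k] k := LinearEquiv.ofFinrankEq N k (hN.trans (Module.finrank_self k).symm)
  let χ : Module.Dual k H :=
    { toFun h := e (h • e.symm 1)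
      map_add' a b := by rw [add_smul, map_add]
      map_smul' c a := by rw [smul_assoc, map_smul, RingHom.id_apply] }
  have hχ (h : H) (n : N) : h • n = χ h • n := by
    apply e.injective
    have hn : n = e n • e.symm 1 := by rw [← map_smul, smul_eq_mul, mul_one, e.symm_apply_apply]
    conv_lhs => rw [hn]
    rw [smul_comm, map_smul e, map_smul e, smul_eq_mul, smul_eq_mul, mul_comm]
    rfl
  refine ⟨e.toLinearMap, χ, e.injective, ⟨?_, fun a b ↦ ?_⟩, hχ⟩
  · change e ((1 : H) • e.symm 1) = 1
    simp
  · change e ((a * b) • e.symm 1) = χ a * χ b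
    rw [mul_smul, hχ a, map_smul]
    rfl

theorem linearMap_eq_zero_of_finrank_eq_one {k H P V : Type} [Field k] [Ring H]
    [Algebra k H] [IsArtinianRing H] (hH : ¬ DualHasNontrivialSkewPrimitiveOf (LinearMap.mul k H) 1)
    [AddCommGroup P] [Module k P] [Module H P] [IsScalarTower k H P]
    [AddCommGroup V] [Module H V] [IsSimpleModule H V]
    {π : P →ₗ[H] V} (hπ : IsProjectiveCoverOf π) {ψ : Module.Dual k H}
    (hψ : IsDualGroupLikeOf (LinearMap.mul k H) 1 ψ) {v : V} (hv : v ≠ 0)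
    (hψv : ∀ h : H, h • v = algebraMap k H (ψ h) • v)
    {N : Type} [AddCommGroup N] [Module k N] [Module H N] [IsScalarTower k H N]
    (hN : Module.finrank k N = 1)
    (q : ((⊥ : Ideal H).jacobson • (⊤ : Submodule H P) : Submodule H P) →ₗ[H] N) : q = 0 := by
  obtain ⟨-, hsurj, hsup⟩ := hπ
  have hker := le_jacobson_bot_smul_top_of_superfluous hsup
  obtain ⟨p, rfl⟩ := hsurj v
  obtain ⟨e, χ, he, hχ, hχN⟩ := exists_isDualGroupLikeOf_of_finrank_eq_one (k := k) (H := H) hN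
  have hp : Submodule.span H {p} = ⊤ := hsup _ <| eq_top_iff.2 fun x _ ↦ by
    obtain ⟨h, hx⟩ := IsSimpleModule.toSpanSingleton_surjective H hv (π x)
    refine Submodule.mem_sup.2
      ⟨h • p, Submodule.smul_mem _ _ (Submodule.mem_span_singleton_self p), x - h • p, ?_, by simp⟩
    rw [LinearMap.mem_ker, map_sub, map_smul, ← hx, LinearMap.toSpanSingleton_apply, sub_self]
  have hD (h : H) : h • p - ψ h • p ∈
      ((⊥ : Ideal H).jacobson • (⊤ : Submodule H P) : Submodule H P) := hker <| by
    rw [LinearMap.mem_ker, map_sub, map_smul, hψv, ← algebraMap_smul H (ψ h) p, map_smul, sub_self]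
  let D (h : H) :
      ((⊥ : Ideal H).jacobson • (⊤ : Submodule H P) : Submodule H P) := ⟨h • p - ψ h • p, hD h⟩
  let F : Module.Dual k H :=
    { toFun h := e (q (D h))
      map_add' a b := by
        rw [← map_add, ← map_add]
        refine congrArg (fun x ↦ e (q x)) (Subtype.ext ?_)
        simp only [D, map_add, add_smul, Submodule.coe_add]
        abel
      map_smul' c a := by
        rw [RingHom.id_apply, ← map_smul, ← LinearMap.map_smul_of_tower]
        refine congrArg (fun x ↦ e (q x)) (Subtype.ext ?_)
        simp only [D, map_smul, smul_assoc, Submodule.coe_smul_of_tower, smul_sub] }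
  have hψmul : ∀ a b, ψ (a * b) = ψ a * ψ b := hψ.2
  have hF (a b : H) : F (a * b) = F a * ψ b + χ a * F b := by
    have hD' : D (a * b) = ψ b • D a + a • D b := Subtype.ext <| by
      have := IsScalarTower.to_smulCommClass' (R := k) (A := H) (M := P)
      simp only [D, hψmul, mul_smul, Submodule.coe_add, Submodule.coe_smul_of_tower, smul_sub,
        smul_comm a (ψ b) p, smul_comm (ψ a) (ψ b) p]
      abel
    change e (q (D (a * b))) = e (q (D a)) * ψ b + χ a * e (q (D b))
    rw [hD', map_add, map_add, LinearMap.map_smul_of_tower, map_smul e, map_smul q, hχN,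
      map_smul e, smul_eq_mul, smul_eq_mul, mul_comm]
  have hq : ∀ x (hx : x ∈ ((⊥ : Ideal H).jacobson • (⊤ : Submodule H P) : Submodule H P)),
      q ⟨x, hx⟩ = 0 := fun x hx ↦ by
    induction hx using Submodule.smul_induction_on' with
    | smul j hj x _ =>
      obtain ⟨h, rfl⟩ := Submodule.mem_span_singleton.1 (hp.ge trivial : x ∈ Submodule.span H {p})
      have hj' : j * h ∈ (⊥ : Ideal H).jacobson := Ideal.mul_mem_right _ _ hj
      have h₀ := apply_eq_zero_of_not_dualHasNontrivialSkewPrimitiveOf hH hψ hχ hF hj'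
      apply he
      rw [map_zero, ← h₀]
      refine congrArg (fun x ↦ e (q x)) (Subtype.ext ?_)
      simp only [D, hψ.apply_eq_zero_of_mem_jacobson_bot hj', zero_smul, sub_zero, mul_smul]
    | add x hx y hy hx' hy' =>
      exact (map_add q ⟨x, hx⟩ ⟨y, hy⟩).trans (by rw [hx', hy', add_zero])
  exact LinearMap.ext fun x ↦ hq x.1 x.2

theorem finrank_ne_one_of_le_quotient {k H I : Type} [Field k] [Ring H]
    [Algebra k H] [IsArtinianRing H] (hH : ¬ DualHasNontrivialSkewPrimitiveOf (LinearMap.mul k H) 1)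
    [AddCommGroup I] [Module k I] [Module H I] [IsScalarTower k H I] (U : Submodule H I)
    (hU : Module.finrank k U = 1) (hess : ∀ N : Submodule H I, N ⊓ U = ⊥ → N = ⊥)
    (N : Submodule H (I ⧸ U)) : Module.finrank k N ≠ 1 := by
  intro hN
  obtain ⟨e, ψ, he, hψ, hψU⟩ := exists_isDualGroupLikeOf_of_finrank_eq_one (k := k) (H := H) hU
  obtain ⟨-, χ, -, hχ, hχN⟩ := exists_isDualGroupLikeOf_of_finrank_eq_one (k := k) (H := H) hN
  have : Nontrivial N := Module.nontrivial_of_finrank_eq_succ hN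
  obtain ⟨⟨n, hnN⟩, hn⟩ := exists_ne (0 : N)
  obtain ⟨x, rfl⟩ := U.mkQ_surjective n
  have hD (h : H) : h • x - χ h • x ∈ U := by
    rw [← U.ker_mkQ, LinearMap.mem_ker, map_sub, map_smul, LinearMap.map_smul_of_tower, sub_eq_zero]
    exact congrArg Subtype.val (hχN h ⟨_, hnN⟩)
  let D (h : H) : U := ⟨h • x - χ h • x, hD h⟩
  let F : Module.Dual k H :=
    { toFun h := e (D h)
      map_add' a b := by
        rw [← map_add]
        refine congrArg e (Subtype.ext ?_)
        simp only [D, map_add, add_smul, Submodule.coe_add]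
        abel
      map_smul' c a := by
        rw [RingHom.id_apply, ← map_smul]
        refine congrArg e (Subtype.ext ?_)
        simp only [D, map_smul, smul_assoc, Submodule.coe_smul_of_tower, smul_sub] }
  have hχmul : ∀ a b, χ (a * b) = χ a * χ b := hχ.2
  have hF (a b : H) : F (a * b) = F a * χ b + ψ a * F b := by
    have hD' : D (a * b) = χ b • D a + a • D b := Subtype.ext <| by
      have := IsScalarTower.to_smulCommClass' (R := k) (A := H) (M := I)
      simp only [D, hχmul, mul_smul, Submodule.coe_add, Submodule.coe_smul_of_tower, smul_sub,
        smul_comm a (χ b) x, smul_comm (χ a) (χ b) x]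
      abel
    change e (D (a * b)) = e (D a) * χ b + ψ a * e (D b)
    rw [hD', map_add, map_smul e, hψU, map_smul e, smul_eq_mul, smul_eq_mul, mul_comm]
  have hJ {j : H} (hj : j ∈ (⊥ : Ideal H).jacobson) : j • x = 0 := by
    have h₀ := apply_eq_zero_of_not_dualHasNontrivialSkewPrimitiveOf hH hχ hψ hF hj
    have h₁ : D j = 0 := he (h₀.trans (map_zero e).symm)
    have h₂ : j • x - χ j • x = 0 := congrArg Subtype.val h₁
    rwa [hχ.apply_eq_zero_of_mem_jacobson_bot hj, zero_smul, sub_zero] at h₂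
  have : IsSemisimpleModule H (Submodule.span H {x}) :=
    isSemisimpleModule_of_jacobson_bot_smul_eq_zero fun j hj ⟨y, hy⟩ ↦ Subtype.ext <| by
      obtain ⟨h, rfl⟩ := Submodule.mem_span_singleton.1 hy
      change j • h • x = 0
      rw [← mul_smul]
      exact hJ (Ideal.mul_mem_right _ _ hj)
  refine hn (Subtype.ext ?_)
  exact (Submodule.Quotient.mk_eq_zero U).2
    (le_of_isSemisimpleModule_of_essential hess (Submodule.mem_span_singleton_self x))

open CategoryTheory in
theorem ModuleCat.finrank_hom_eq {k H M N : Type} [Field k] [Ring H] [Algebra k H]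
    [AddCommGroup M] [Module H M] [AddCommGroup N] [Module k N] [Module H N]
    [IsScalarTower k H N] :
    @Module.finrank k (ModuleCat.of H M ⟶ ModuleCat.of H N) _ _ (Linear.homModule _ _) =
      Module.finrank k (M →ₗ[H] N) :=
  letI : Module k (ModuleCat.of H M ⟶ ModuleCat.of H N) := Linear.homModule _ _
  LinearEquiv.finrank_eq
    { ModuleCat.homAddEquiv with
      map_smul' c f := LinearMap.ext fun x ↦ algebraMap_smul H c (f.hom x) }

open CategoryTheory in
theorem finrank_jacobson_smul_hom_eq_and_finrank_Ext_one_eq {k H P V W I : Type} [Field k] [Ring H]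
    [Algebra k H] [IsArtinianRing H]
    [AddCommGroup V] [Module k V] [Module H V] [IsScalarTower k H V] [IsSimpleModule H V]
    [AddCommGroup W] [Module k W] [Module H W] [IsScalarTower k H W] [IsSimpleModule H W]
    [AddCommGroup P] [Module H P] {π : P →ₗ[H] V} (hπ : IsProjectiveCoverOf π)
    [AddCommGroup I] [Module k I] [Module H I] [IsScalarTower k H I] [Module.Injective H I]
    {ι : W →ₗ[H] I} (hι : Function.Injective ι)
    (hess : ∀ N : Submodule H I, N ⊓ LinearMap.range ι = ⊥ → N = ⊥) :
    Module.finrank k (((⊥ : Ideal H).jacobson • (⊤ : Submodule H P) : Submodule H P) →ₗ[H] W) =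
        Module.finrank k (V →ₗ[H] I ⧸ LinearMap.range ι) ∧
      Module.finrank k (((Ext k (ModuleCat.{0} H) 1).obj
        (Opposite.op (ModuleCat.of H V))).obj (ModuleCat.of H W)) =
          Module.finrank k (V →ₗ[H] I ⧸ LinearMap.range ι) := by
  obtain ⟨_, hsurj, hsup⟩ := hπ
  set JP := (⊥ : Ideal H).jacobson • (⊤ : Submodule H P)
  have hker : LinearMap.ker π = JP :=
    (le_jacobson_bot_smul_top_of_superfluous hsup).antisymm (jacobson_bot_smul_top_le_ker π)
  have : Projective (ModuleCat.of H P) := (IsProjective.iff_projective P).1 ‹_›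
  have : Injective (ModuleCat.of H I) := Module.injective_object_of_injective_module H I
  have : Mono (ModuleCat.ofHom JP.subtype) :=
    (ModuleCat.mono_iff_injective _).2 JP.injective_subtype
  have : Epi (ModuleCat.ofHom π) := (ModuleCat.epi_iff_surjective _).2 hsurj
  have : Mono (ModuleCat.ofHom ι) := (ModuleCat.mono_iff_injective _).2 hι
  have : Epi (ModuleCat.ofHom (LinearMap.range ι).mkQ) :=
    (ModuleCat.epi_iff_surjective _).2 (Submodule.mkQ_surjective _)
  have hjπ : ModuleCat.ofHom JP.subtype ≫ ModuleCat.ofHom π = 0 :=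
    ModuleCat.hom_ext <| LinearMap.ext fun x ↦ hker.ge x.2
  have hιq : ModuleCat.ofHom ι ≫ ModuleCat.ofHom (LinearMap.range ι).mkQ = 0 :=
    ModuleCat.hom_ext (LinearMap.range_mkQ_comp ι)
  have exjπ : (ShortComplex.mk _ _ hjπ).Exact :=
    (ShortComplex.ShortExact.moduleCat_exact_iff_function_exact _).2
      (LinearMap.exact_iff.2 (hker.trans JP.range_subtype.symm))
  have exιq : (ShortComplex.mk _ _ hιq).Exact :=
    (ShortComplex.ShortExact.moduleCat_exact_iff_function_exact _).2
      (LinearMap.exact_iff.2 (Submodule.ker_mkQ _))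
  have hVI (t : ModuleCat.of H V ⟶ ModuleCat.of H I) :
      t ≫ ModuleCat.ofHom (LinearMap.range ι).mkQ = 0 := by
    have : IsSemisimpleModule H (LinearMap.range t.hom) :=
      .of_surjective _ (LinearMap.surjective_rangeRestrict (t.hom : V →ₗ[H] I))
    refine ModuleCat.hom_ext <| LinearMap.ext fun v ↦ (Submodule.Quotient.mk_eq_zero _).2 ?_
    exact le_of_isSemisimpleModule_of_essential hess (LinearMap.mem_range_self t.hom v)
  have hPW (t : ModuleCat.of H P ⟶ ModuleCat.of H W) : ModuleCat.ofHom JP.subtype ≫ t = 0 :=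
    ModuleCat.hom_ext <| LinearMap.ext fun x ↦ jacobson_bot_smul_top_le_ker t.hom x.2
  rw [← ModuleCat.finrank_hom_eq (M := V), ← ModuleCat.finrank_hom_eq (N := W)]
  exact ⟨finrank_kernel_hom_eq _ _ hjπ exjπ _ _ hιq exιq hVI hPW,
    finrank_Ext_one_eq _ _ hιq exιq hVI⟩

/-- for a finite-dimensional non-semisimple Hopf algebra `H` with Jacobson
radical `J` and simple modules `V`, `W`:
`[J·P(V)/J²·P(V) : W] = dim Ext¹(V, W) = [Soc(I(W)/W) : V]`; moreover, if the dual Hopf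
algebra `H*` has no non-trivial skew primitive element, then no simple `H`-submodule of
`J·P(𝟙)/J²·P(𝟙)`, nor of `Soc(I(𝟙)/𝟙)`, is `1`-dimensional, where `𝟙 = k` is the trivial
`H`-module (via the counit).  Since the modules `J·P/J²·P` and `Soc(I(W)/W)` are semisimple
and `k` is algebraically closed, the multiplicity `[M : U]` of a simple module `U` in them
equals `dim_k Hom_H(M, U)`. -/
theorem radical_layer_ext_socle_multiplicities
    (k : Type) [Field k] [IsAlgClosed k] [CharZero k]
    (H : Type) [Ring H] [HopfAlgebra k H] [FiniteDimensional k H]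
    (hns : ¬ IsSemisimpleRing H) :
    (∀ (V W : Type) [AddCommGroup V] [Module k V] [Module H V] [IsScalarTower k H V]
      [SMulCommClass H k V] [AddCommGroup W] [Module k W] [Module H W] [IsScalarTower k H W]
      [SMulCommClass H k W], IsSimpleModule H V → IsSimpleModule H W →
      ∀ (P : Type) [AddCommGroup P] [Module k P] [Module H P] [IsScalarTower k H P]
        (π : P →ₗ[H] V), IsProjectiveCoverOf π →
      ∀ (I : Type) [AddCommGroup I] [Module k I] [Module H I] [IsScalarTower k H I]
        (ι : W →ₗ[H] I), Module.Injective H I → Function.Injective ι →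
        (∀ N : Submodule H I, N ⊓ LinearMap.range ι = ⊥ → N = ⊥) →
      (Module.finrank k
          ((↥((⊥ : Ideal H).jacobson • (⊤ : Submodule H P)) ⧸
              ((⊥ : Ideal H).jacobson •
                (⊤ : Submodule H ↥((⊥ : Ideal H).jacobson • (⊤ : Submodule H P))))) →ₗ[H] W) =
        Module.finrank k
          (((Ext k (ModuleCat.{0} H) 1).obj
              (Opposite.op (ModuleCat.of H V))).obj (ModuleCat.of H W)) ∧
      Module.finrank k
          (((Ext k (ModuleCat.{0} H) 1).obj
              (Opposite.op (ModuleCat.of H V))).obj (ModuleCat.of H W)) =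
        Module.finrank k
          (↥(moduleSocle H (I ⧸ LinearMap.range ι)) →ₗ[H] V))) ∧
    (¬ DualHasNontrivialSkewPrimitiveOf (LinearMap.mul k H) 1 →
      (∀ (P : Type) [AddCommGroup P] [Module k P] [Module H P] [IsScalarTower k H P]
        (π : P →ₗ[H] k), IsProjectiveCoverOf π →
        ∀ N : Submodule H
          (↥((⊥ : Ideal H).jacobson • (⊤ : Submodule H P)) ⧸
            ((⊥ : Ideal H).jacobson •
              (⊤ : Submodule H ↥((⊥ : Ideal H).jacobson • (⊤ : Submodule H P))))),
          IsSimpleModule H N → Module.finrank k N ≠ 1) ∧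
      (∀ (I : Type) [AddCommGroup I] [Module k I] [Module H I] [IsScalarTower k H I]
        (ι : k →ₗ[H] I), Module.Injective H I → Function.Injective ι →
        (∀ N : Submodule H I, N ⊓ LinearMap.range ι = ⊥ → N = ⊥) →
        ∀ N : Submodule H (I ⧸ LinearMap.range ι),
          N ≤ moduleSocle H (I ⧸ LinearMap.range ι) →
          IsSimpleModule H N → Module.finrank k N ≠ 1)) := by
  have : IsArtinianRing H := IsArtinianRing.of_finite k H
  refine ⟨?_, fun hH ↦ ⟨?_, ?_⟩⟩
  · intro V W _ _ _ _ _ _ _ _ _ _ _ _ P _ _ _ _ π hπ I _ _ _ _ ι _ hι hess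
    obtain ⟨h₁, h₂⟩ := finrank_jacobson_smul_hom_eq_and_finrank_Ext_one_eq (k := k) hπ hι hess
    rw [finrank_quotient_hom_eq _ jacobson_bot_smul_top_le_ker, h₁, h₂]
    have : IsSemisimpleModule H (moduleSocle H (I ⧸ LinearMap.range ι)) :=
      isSemisimpleModule_sSup_isSimpleModule
    rw [← finrank_hom_comm_of_isSemisimpleModule (S := V)]
    exact ⟨rfl, (finrank_hom_submodule_eq _ range_le_sSup_isSimpleModule).symm⟩
  · intro P _ _ _ _ π hπ N _ hN
    have hε : IsDualGroupLikeOf (LinearMap.mul k H) 1 (Coalgebra.counit (R := k) (A := H)) :=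
      ⟨Bialgebra.counit_one, fun a b ↦ Bialgebra.counit_mul a b⟩
    have hsmul (h : H) (c : k) : h • c = Coalgebra.counit (R := k) h * c := rfl
    have : IsSimpleModule H k := isSimpleModule_iff_toSpanSingleton_surjective.2
      ⟨inferInstance, fun c hc d ↦ ⟨algebraMap k H (d * c⁻¹), by
        rw [LinearMap.toSpanSingleton_apply, hsmul, Bialgebra.counit_algebraMap,
          inv_mul_cancel_right₀ hc]⟩⟩
    obtain ⟨r, hr⟩ := IsSemisimpleModule.extension_property N.subtype N.injective_subtype
      LinearMap.id
    have h₀ := linearMap_eq_zero_of_finrank_eq_one hH hπ hε one_ne_zero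
      (fun h ↦ by rw [hsmul, hsmul, Bialgebra.counit_algebraMap]) hN (r ∘ₗ Submodule.mkQ _)
    have := IsSimpleModule.nontrivial H N
    obtain ⟨n, hn⟩ := exists_ne (0 : N)
    obtain ⟨x, hx⟩ := Submodule.mkQ_surjective _ n.1
    refine hn ?_
    have h₁ : r n.1 = n := LinearMap.congr_fun hr n
    rw [← h₁, ← hx]
    exact LinearMap.congr_fun h₀ x
  · intro I _ _ _ _ ι _ hι hess N _ _
    refine finrank_ne_one_of_le_quotient hH _ ?_ hess N
    refine finrank_eq_one ⟨ι 1, 1, rfl⟩ (fun h ↦ ?_) ?_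
    · exact one_ne_zero (hι ((congrArg Subtype.val h).trans (map_zero ι).symm))
    · rintro ⟨_, c, rfl⟩
      refine ⟨c, Subtype.ext ?_⟩
      have hc : algebraMap k H c • (1 : k) = c := by
        change Coalgebra.counit (R := k) (algebraMap k H c) * 1 = c
        rw [Bialgebra.counit_algebraMap, mul_one]
      change c • ι 1 = ι c
      rw [← algebraMap_smul H c (ι 1), ← map_smul, hc]
end

section
/- Let H be a non-semisimple finite-dimensional Hopf algebra over an algebraically closed field k of characteristic zero with antipode S, and suppose the order of S² is p^n for some prime p and positive integer n. Then every indecomposable projective H-module P satisfying P ≅ P^{∨∨} as H-modules has dimension divisible by p. -/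
open Polynomial in
/-- If a sum of `m` elements of a field of characteristic zero vanishes, each of them having the
same nonzero `p ^ n`-th power, then `p` divides `m`. -/
theorem Multiset.prime_dvd_card_of_sum_eq_zero {k : Type*} [Field k] [IsAlgClosed k] [CharZero k]
    {p n : ℕ} (hp : p.Prime) (hn : 0 < n) {μ : k} (hμ : μ ≠ 0) (s : Multiset k)
    (hs : ∀ z ∈ s, z ^ p ^ n = μ) (hsum : s.sum = 0) : p ∣ s.card := by
  have hpn : 0 < p ^ n := pow_pos hp.pos n
  have : NeZero (p ^ n) := ⟨hpn.ne'⟩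
  have : NeZero ((p ^ n : ℕ) : k) := ⟨Nat.cast_ne_zero.mpr hpn.ne'⟩
  obtain ⟨ζ, hζ⟩ := HasEnoughRootsOfUnity.exists_primitiveRoot k (p ^ n)
  obtain ⟨w, hw⟩ := IsAlgClosed.exists_pow_nat_eq μ hpn
  have hw0 : w ≠ 0 := by
    rintro rfl
    exact hμ (by rw [← hw, zero_pow hpn.ne'])
  have hroot : ∀ z : k, ∃ i : ℕ, z ^ p ^ n = μ → z = w * ζ ^ i := by
    intro z
    by_cases hz : z ^ p ^ n = μ
    · obtain ⟨i, -, hi⟩ := hζ.eq_pow_of_pow_eq_one (ξ := z / w) (by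
        rw [div_pow, hz, hw, div_self hμ])
      exact ⟨i, fun _ => by rw [hi, mul_div_cancel₀ _ hw0]⟩
    · exact ⟨0, fun h => absurd h hz⟩
  choose e he using hroot
  have : Fact p.Prime := ⟨hp⟩
  obtain ⟨m, rfl⟩ : ∃ m, n = m + 1 := ⟨n - 1, by omega⟩
  set f : ℤ[X] := (s.map fun z => (X : ℤ[X]) ^ e z).sum with hf
  have hf1 : f.eval 1 = s.card := by
    rw [hf, ← Polynomial.coe_evalRingHom, map_multiset_sum, Multiset.map_map]
    simp
  have hf0 : aeval ζ f = 0 := by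
    refine (mul_eq_zero.mp ?_).resolve_left hw0
    rw [hf, map_multiset_sum, Multiset.map_map, ← Multiset.sum_map_mul_left, ← hsum]
    conv_rhs => rw [← Multiset.map_id s]
    refine congrArg Multiset.sum (Multiset.map_congr rfl fun z hz => ?_)
    simpa using (he z (hs z hz)).symm
  obtain ⟨g, hg⟩ := minpoly.isIntegrallyClosed_dvd (hζ.isIntegral hpn) hf0
  rw [← cyclotomic_eq_minpoly hζ hpn] at hg
  have := congrArg (Polynomial.eval 1) hg
  rw [hf1, eval_mul, eval_one_cyclotomic_prime_pow] at this
  exact Int.natCast_dvd_natCast.mp ⟨_, this⟩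

/-- An eigenvalue of an endomorphism of an indecomposable finite-dimensional module is the only
one. -/
theorem Module.End.exists_pow_sub_algebraMap_eq_zero_of_indecomposable {k H P : Type*} [Field k]
    [IsAlgClosed k] [Ring H] [Algebra k H] [AddCommGroup P] [Module k P] [Module H P]
    [IsScalarTower k H P] [FiniteDimensional k P] [Nontrivial P]
    (hindec : ∀ N N' : Submodule H P, IsCompl N N' → N = ⊥ ∨ N = ⊤)
    (T : Module.End k P) (hT : ∀ (h : H) (v : P), T (h • v) = h • T v) :
    ∃ (μ : k) (m : ℕ), (T - algebraMap k (Module.End k P) μ) ^ m = 0 := by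
  obtain ⟨μ, hμ⟩ := Module.End.exists_eigenvalue T
  have : IsNoetherian H P := isNoetherian_of_tower k inferInstance
  have : IsArtinian H P := isArtinian_of_tower k inferInstance
  let D : Module.End H P :=
    { toFun := fun v => T v - μ • v
      map_add' := fun v w => by simp [sub_add_sub_comm]
      map_smul' := fun h v => by simp [hT, smul_sub, ← smul_algebra_smul_comm] }
  have hD : ∀ (m : ℕ) (v : P), (D ^ m) v = ((T - algebraMap k (Module.End k P) μ) ^ m) v := by
    intro m
    induction m with
    | zero => simp
    | succ m ih =>
      intro v
      rw [pow_succ, pow_succ, Module.End.mul_apply, Module.End.mul_apply, ih]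
      rfl
  obtain ⟨m, hm⟩ := (D.eventually_isCompl_ker_pow_range_pow).exists_forall_of_atTop
  obtain hbot | htop := hindec _ _ (hm (m + 1) (Nat.le_succ m))
  · obtain ⟨v, hv⟩ := hμ.exists_hasEigenvector
    refine absurd (LinearMap.ker_eq_bot.mp hbot ?_) hv.2
    rw [pow_succ, Module.End.mul_apply, show D v = 0 from sub_eq_zero.mpr hv.apply_eq_smul,
      map_zero, map_zero]
  · refine ⟨μ, m + 1, LinearMap.ext fun v => ?_⟩
    rw [← hD]
    exact LinearMap.mem_ker.mp (htop ▸ Submodule.mem_top : v ∈ LinearMap.ker (D ^ (m + 1)))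

namespace HopfAlgebra

open Coalgebra

section Sweedler

variable {k A E : Type*} [CommSemiring k] [Semiring A] [HopfAlgebra k A] [Semiring E] [Algebra k E]

theorem sum_sum_mul_mul (f g h : A →ₗ[k] E) (a : A) :
    ∑ i ∈ (ℛ k a).index, (∑ j ∈ (ℛ k ((ℛ k a).left i)).index,
        f ((ℛ k ((ℛ k a).left i)).left j) * g ((ℛ k ((ℛ k a).left i)).right j)) *
          h ((ℛ k a).right i) =
      ∑ i ∈ (ℛ k a).index, f ((ℛ k a).left i) * ∑ j ∈ (ℛ k ((ℛ k a).right i)).index,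
        g ((ℛ k ((ℛ k a).right i)).left j) * h ((ℛ k ((ℛ k a).right i)).right j) := by
  have key := congr($(mul_assoc (WithConv.toConv f) (WithConv.toConv g) (WithConv.toConv h)) a)
  rw [(ℛ k a).convMul_apply, (ℛ k a).convMul_apply] at key
  simpa only [(ℛ k ((ℛ k a).left _)).convMul_apply, (ℛ k ((ℛ k a).right _)).convMul_apply]
    using key

theorem sum_sum_mul_mul_rev (f g h : A →ₗ[k] E) (a : A) :
    ∑ i ∈ (ℛ k a).index, h ((ℛ k a).right i) * ∑ j ∈ (ℛ k ((ℛ k a).left i)).index,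
        g ((ℛ k ((ℛ k a).left i)).right j) * f ((ℛ k ((ℛ k a).left i)).left j) =
      ∑ i ∈ (ℛ k a).index, (∑ j ∈ (ℛ k ((ℛ k a).right i)).index,
        h ((ℛ k ((ℛ k a).right i)).right j) * g ((ℛ k ((ℛ k a).right i)).left j)) *
          f ((ℛ k a).left i) := by
  have key := sum_sum_mul_mul (E := Eᵐᵒᵖ) ((MulOpposite.opLinearEquiv k).toLinearMap ∘ₗ f)
    ((MulOpposite.opLinearEquiv k).toLinearMap ∘ₗ g)
    ((MulOpposite.opLinearEquiv k).toLinearMap ∘ₗ h) a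
  apply MulOpposite.op_injective
  simpa using key

theorem sum_counit_right_smul (a : A) :
    ∑ i ∈ (ℛ k a).index, counit (R := k) ((ℛ k a).right i) • (ℛ k a).left i = a := by
  simpa only [map_sum, TensorProduct.lift.tmul, LinearMap.flip_apply, LinearMap.lsmul_apply,
    one_smul] using congr(TensorProduct.lift (LinearMap.lsmul k A).flip
      $(sum_tmul_counit_eq (R := k) (ℛ k a)))

/-- The adjoint action `a ↦ ∑ ρ(a₁) x ρ(S(a₂))` of a Hopf algebra on an element `x` of an algebra
`E` under it. -/
noncomputable def adjointAction (ρ : A →ₐ[k] E) (x : E) : A →ₗ[k] E :=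
  (WithConv.toConv (LinearMap.mulRight k x ∘ₗ ρ.toLinearMap) *
    WithConv.toConv (ρ.toLinearMap ∘ₗ antipode k)).ofConv

theorem adjointAction_apply {ι : Type*} (ρ : A →ₐ[k] E) (x : E) {a : A} (r : Repr k a ι) :
    adjointAction ρ x a = ∑ i ∈ r.index, ρ (r.left i) * x * ρ (antipode k (r.right i)) :=
  r.convMul_apply _ _

theorem adjointAction_mul (ρ : A →ₐ[k] E) (x : E) (a b : A) :
    adjointAction ρ x (a * b) = adjointAction ρ (adjointAction ρ x b) a := by
  rw [adjointAction_apply ρ x ((ℛ k a).mul (ℛ k b)), adjointAction_apply ρ _ (ℛ k a),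
    adjointAction_apply ρ x (ℛ k b)]
  simp [Finset.sum_product, Finset.mul_sum, Finset.sum_mul, antipode_mul_antidistrib, mul_assoc]

theorem sum_adjointAction_mul (ρ : A →ₐ[k] E) (x : E) (a : A) :
    ∑ i ∈ (ℛ k a).index, adjointAction ρ x ((ℛ k a).left i) * ρ ((ℛ k a).right i) =
      ρ a * x := by
  have key := sum_sum_mul_mul (LinearMap.mulRight k x ∘ₗ ρ.toLinearMap)
    (ρ.toLinearMap ∘ₗ antipode k) ρ.toLinearMap a
  simp only [LinearMap.coe_comp, Function.comp_apply, AlgHom.toLinearMap_apply,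
    LinearMap.mulRight_apply, ← map_mul ρ, ← map_sum ρ, sum_antipode_mul_eq_smul] at key
  simp only [adjointAction_apply ρ x (ℛ k ((ℛ k a).left _))]
  rw [key]
  conv_rhs => rw [← sum_counit_right_smul (k := k) a]
  simp [Finset.sum_mul]

/-- The adjoint action of a left integral produces elements commuting with the algebra. -/
theorem commute_adjointAction_of_integral (ρ : A →ₐ[k] E) (x : E) {Λ : A}
    (hΛ : ∀ a : A, a * Λ = counit (R := k) a • Λ) (a : A) :
    Commute (ρ a) (adjointAction ρ x Λ) := by
  rw [Commute, SemiconjBy, ← sum_adjointAction_mul]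
  simp only [← adjointAction_mul, hΛ, map_smul]
  conv_rhs => rw [← sum_counit_smul (ℛ k a)]
  simp [Finset.mul_sum]

end Sweedler

/-- The Maschke theorem for Hopf algebras: a normalized left integral makes every module
semisimple. -/
theorem isSemisimpleModule_of_integral {k H M : Type*} [Field k] [Ring H] [HopfAlgebra k H]
    [AddCommGroup M] [Module k M] [Module H M] [IsScalarTower k H M] {Λ : H}
    (hΛ : ∀ h : H, h * Λ = counit (R := k) h • Λ) (hΛ1 : counit (R := k) Λ = 1) :
    IsSemisimpleModule H M := by
  refine (isSemisimpleModule_iff H M).mpr ⟨fun N => ?_⟩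
  obtain ⟨q, hq⟩ := (N.restrictScalars k).exists_isCompl
  let π : Module.End k M :=
    (N.restrictScalars k).subtype ∘ₗ (N.restrictScalars k).projectionOnto q hq
  have hπ : ∀ v, π v ∈ N := fun v => ((N.restrictScalars k).projectionOnto q hq v).2
  have hπN : ∀ v ∈ N, π v = v := fun v hv =>
    congrArg Subtype.val (Submodule.projectionOnto_apply_left hq ⟨v, hv⟩)
  let ρ : H →ₐ[k] Module.End k M := Algebra.lsmul k k M
  let A : Module.End k M := adjointAction ρ π Λ
  have hA : ∀ v, A v = ∑ i ∈ (ℛ k Λ).index,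
      (ℛ k Λ).left i • π (antipode k ((ℛ k Λ).right i) • v) := by
    intro v
    simp [A, adjointAction_apply ρ π (ℛ k Λ), ρ]
  let f : M →ₗ[H] N :=
    { toFun := fun v => ⟨A v, by
        rw [hA]
        exact N.sum_mem fun i _ => N.smul_mem _ (hπ _)⟩
      map_add' := fun v w => Subtype.ext (map_add A v w)
      map_smul' := fun h v => Subtype.ext
        (LinearMap.congr_fun (commute_adjointAction_of_integral ρ π hΛ h).eq v).symm }
  refine ⟨LinearMap.ker f, LinearMap.isCompl_of_proj fun v => Subtype.ext ?_⟩
  change A v = v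
  rw [hA]
  have h1 : ∀ i, π (antipode k ((ℛ k Λ).right i) • (v : M)) =
      antipode k ((ℛ k Λ).right i) • (v : M) := fun i => hπN _ (N.smul_mem _ v.2)
  simp only [h1, ← mul_smul]
  rw [← Finset.sum_smul, sum_mul_antipode_eq_smul, hΛ1, one_smul, one_smul]

section Projective

variable {k H P : Type*} [Field k] [Ring H] [HopfAlgebra k H] [AddCommGroup P] [Module k P]
  [Module H P] [IsScalarTower k H P]

/-- The contraction `a ↦ ∑ f(a₁) a₂` of the comultiplication with a linear form. -/
noncomputable def contractLeft : Module.Dual k H →ₗ[k] Module.End k H where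
  toFun f := TensorProduct.lift (LinearMap.lsmul k H ∘ₗ f) ∘ₗ comul
  map_add' f g := by
    ext a
    simp [← (ℛ k a).eq, Finset.sum_add_distrib]
  map_smul' c f := by
    ext a
    simp [← (ℛ k a).eq, mul_smul, Finset.smul_sum]

theorem contractLeft_apply {ι : Type*} (f : Module.Dual k H) {a : H} (r : Repr k a ι) :
    contractLeft f a = ∑ i ∈ r.index, f (r.left i) • r.right i := by
  simp [contractLeft, ← r.eq]

theorem contractLeft_mul (f : Module.Dual k H) (a b : H) :
    contractLeft f (a * b) = ∑ i ∈ (ℛ k a).index,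
      (ℛ k a).right i * contractLeft (f ∘ₗ LinearMap.mulLeft k ((ℛ k a).left i)) b := by
  rw [contractLeft_apply f ((ℛ k a).mul (ℛ k b))]
  simp [contractLeft_apply _ (ℛ k b), Finset.sum_product, Finset.mul_sum]

/-- A section `s` of the free cover of `P` gives a map `P → H ⊗ P`, linear for the diagonal
action; this is its contraction with a linear form on `H`. -/
noncomputable def contractSection (s : P →ₗ[H] (P →₀ H)) :
    Module.Dual k H →ₗ[k] Module.End k P where
  toFun f := (Finsupp.linearCombination H (id : P → P)).restrictScalars k ∘ₗ
    Finsupp.mapRange.linearMap (contractLeft f) ∘ₗ s.restrictScalars k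
  map_add' f g := by
    ext v
    simp [Finsupp.linearCombination_apply, Finsupp.sum_mapRange_index, add_smul]
  map_smul' c f := by
    ext v
    simp [Finsupp.linearCombination_apply, Finsupp.sum_mapRange_index, Finsupp.smul_sum]

theorem contractSection_apply (s : P →ₗ[H] (P →₀ H)) (f : Module.Dual k H) (v : P) :
    contractSection s f v = (s v).sum fun x a => contractLeft f a • x := by
  simp [contractSection, Finsupp.linearCombination_apply, Finsupp.sum_mapRange_index]

theorem contractSection_counit (s : P →ₗ[H] (P →₀ H))
    (hs : Function.LeftInverse (Finsupp.linearCombination H id) s) :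
    contractSection (k := k) s counit = 1 := by
  ext v
  rw [contractSection_apply]
  simp only [contractLeft_apply _ (ℛ k _), sum_counit_smul]
  exact hs v

theorem contractSection_mul_lsmul (s : P →ₗ[H] (P →₀ H)) (f : Module.Dual k H) (h : H) :
    contractSection s f * Algebra.lsmul k k P h = ∑ i ∈ (ℛ k h).index,
      Algebra.lsmul k k P ((ℛ k h).right i) *
        contractSection s (f ∘ₗ LinearMap.mulLeft k ((ℛ k h).left i)) := by
  ext v
  simp only [Module.End.mul_apply, Algebra.lsmul_coe, contractSection_apply, map_smul,
    LinearMap.sum_apply]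
  rw [Finsupp.sum_smul_index (by simp)]
  simp only [contractLeft_mul, Finset.sum_smul, Finsupp.sum, Finset.smul_sum, mul_smul]
  exact Finset.sum_comm

theorem trace_mul_contractSection_mulLeft (s : P →ₗ[H] (P →₀ H)) (ψ : Module.End k P)
    (hψ : ∀ (h : H) (v : P), ψ (h • v) = antipode k (antipode k h) • ψ v)
    (f : Module.Dual k H) (h : H) :
    LinearMap.trace k P (ψ * contractSection s (f ∘ₗ LinearMap.mulLeft k h)) =
      counit (R := k) h * LinearMap.trace k P (ψ * contractSection s f) := by
  let ρ : H →ₐ[k] Module.End k P := Algebra.lsmul k k P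
  have hρ : ∀ a, ψ * ρ a = ρ (antipode k (antipode k a)) * ψ := fun a =>
    LinearMap.ext fun v => hψ a v
  let B : H →ₗ[k] Module.End k P :=
    contractSection s ∘ₗ LinearMap.compRight k f ∘ₗ LinearMap.mul k H
  have hB : ∀ a, B a = contractSection s (f ∘ₗ LinearMap.mulLeft k a) := fun a => rfl
  have key := sum_sum_mul_mul_rev B ρ.toLinearMap
    (LinearMap.mulRight k ψ ∘ₗ ρ.toLinearMap ∘ₗ antipode k) h
  simp only [hB, LinearMap.coe_comp, Function.comp_apply, AlgHom.toLinearMap_apply,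
    LinearMap.mulRight_apply] at key
  have hL : ∀ a, ∑ j ∈ (ℛ k a).index, ρ ((ℛ k a).right j) *
      contractSection s (f ∘ₗ LinearMap.mulLeft k ((ℛ k a).left j)) = contractSection s f * ρ a :=
    fun a => (contractSection_mul_lsmul s f a).symm
  have hR : ∀ a, ∑ j ∈ (ℛ k a).index, ρ (antipode k ((ℛ k a).right j)) * ψ * ρ ((ℛ k a).left j) =
      counit (R := k) a • ψ := by
    intro a
    simp only [mul_assoc, hρ]
    simp only [← mul_assoc, ← map_mul ρ, ← antipode_mul_antidistrib]
    rw [← Finset.sum_mul, ← map_sum, ← map_sum, sum_antipode_mul_eq_smul]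
    simp
  simp only [hL, hR] at key
  have hsum : ∑ i ∈ (ℛ k h).index, (counit (R := k) ((ℛ k h).right i) • ψ) *
      contractSection s (f ∘ₗ LinearMap.mulLeft k ((ℛ k h).left i)) =
      ψ * contractSection s (f ∘ₗ LinearMap.mulLeft k h) := by
    conv_rhs => rw [← hB, ← sum_counit_right_smul (k := k) h]
    simp only [map_sum, map_smul, Finset.mul_sum, smul_mul_assoc, mul_smul_comm, ← hB]
  rw [← hsum, ← key, map_sum]
  have hcyc : ∀ i, LinearMap.trace k P (ρ (antipode k ((ℛ k h).right i)) * ψ *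
      (contractSection s f * ρ ((ℛ k h).left i))) = LinearMap.trace k P
        (ρ ((ℛ k h).left i * antipode k ((ℛ k h).right i)) * (ψ * contractSection s f)) := by
    intro i
    rw [← mul_assoc, LinearMap.trace_mul_comm, map_mul ρ]
    simp only [mul_assoc]
  simp only [hcyc]
  rw [← map_sum, ← Finset.sum_mul, ← map_sum, sum_mul_antipode_eq_smul]
  simp

/-- An isomorphism of a projective module with its bidual has trace zero unless the Hopf algebra
is semisimple. -/
theorem trace_eq_zero_of_projective [FiniteDimensional k H] (hns : ¬ IsSemisimpleRing H)
    [Module.Projective H P] (ψ : Module.End k P)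
    (hψ : ∀ (h : H) (v : P), ψ (h • v) = antipode k (antipode k h) • ψ v) :
    LinearMap.trace k P ψ = 0 := by
  by_contra htr
  obtain ⟨s, hs⟩ := Module.projective_def.mp ‹Module.Projective H P›
  let φ : Module.Dual k (Module.Dual k H) :=
    LinearMap.trace k P ∘ₗ LinearMap.mulLeft k ψ ∘ₗ contractSection s
  let Λ : H := (Module.evalEquiv k H).symm φ
  have hΛ : ∀ f : Module.Dual k H, f Λ = LinearMap.trace k P (ψ * contractSection s f) := fun f =>
    Module.apply_evalEquiv_symm_apply k H f φ
  have hint : ∀ h : H, h * Λ = counit (R := k) h • Λ := by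
    intro h
    refine (Module.evalEquiv k H).injective (LinearMap.ext fun f => ?_)
    change f (h * Λ) = f (counit (R := k) h • Λ)
    rw [map_smul, hΛ, smul_eq_mul, ← trace_mul_contractSection_mulLeft s ψ hψ, ← hΛ]
    rfl
  have hε : counit (R := k) Λ = LinearMap.trace k P ψ := by
    rw [hΛ, contractSection_counit s hs, mul_one]
  refine hns (isSemisimpleModule_of_integral (k := k) (Λ := (LinearMap.trace k P ψ)⁻¹ • Λ)
    (fun h => ?_) ?_)
  · rw [mul_smul_comm, hint, smul_comm]
  · rw [map_smul, hε, smul_eq_mul, inv_mul_cancel₀ htr]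

end Projective

end HopfAlgebra

/-- let `H` be a non-semisimple finite-dimensional Hopf algebra over an
algebraically closed field `k` of characteristic zero whose antipode `S` satisfies
`ord (S²) = pⁿ` for a prime `p` and `n ≥ 1`.  Then every nonzero indecomposable projective
`H`-module `P` with `P ≅ P^∨∨` has dimension divisible by `p`.  (As before, `P ≅ P^∨∨` is
expressed via the canonical identification `P^∨∨ ≅ ₛ₂P` as the existence of a `k`-linear
automorphism `ψ` of `P` with `ψ (h • v) = S²(h) • ψ v`.) -/
theorem indecomposable_projective_bidual_dim_dvd
    (k : Type) [Field k] [IsAlgClosed k] [CharZero k]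
    (H : Type) [Ring H] [HopfAlgebra k H] [FiniteDimensional k H]
    (hns : ¬ IsSemisimpleRing H)
    (p n : ℕ) (hp : p.Prime) (hn : 0 < n)
    (hord : orderOf ((HopfAlgebra.antipode (R := k) (A := H) : Module.End k H) ^ 2) = p ^ n)
    (P : Type) [AddCommGroup P] [Module k P] [Module H P] [IsScalarTower k H P]
    [Nontrivial P]
    (hproj : Module.Projective H P)
    (hindec : ∀ N N' : Submodule H P, IsCompl N N' → N = ⊥ ∨ N = ⊤)
    (hbidual : ∃ ψ : P ≃ₗ[k] P, ∀ (h : H) (v : P),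
      ψ (h • v) = HopfAlgebra.antipode (R := k) (HopfAlgebra.antipode (R := k) h) • ψ v) :
    p ∣ Module.finrank k P := by
  obtain ⟨ψ, hψ⟩ := hbidual
  by_cases hfin : FiniteDimensional k P
  swap
  · rw [Module.finrank_of_not_finite hfin]
    exact dvd_zero p
  have htr := HopfAlgebra.trace_eq_zero_of_projective hns ψ.toLinearMap hψ
  have hiter : ∀ (m : ℕ) (h : H) (v : P), (ψ.toLinearMap ^ m) (h • v) =
      (((HopfAlgebra.antipode k : Module.End k H) ^ 2) ^ m) h • (ψ.toLinearMap ^ m) v := by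
    intro m
    induction m with
    | zero => simp
    | succ m ih =>
      intro h v
      rw [pow_succ', pow_succ' _ m, Module.End.mul_apply, ih, LinearEquiv.coe_coe, hψ]
      rfl
  obtain ⟨μ, m, hμ⟩ := Module.End.exists_pow_sub_algebraMap_eq_zero_of_indecomposable hindec
    (ψ.toLinearMap ^ p ^ n) (fun h v => by rw [hiter, ← hord, pow_orderOf_eq_one]; rfl)
  have hroots : ∀ z ∈ ψ.toLinearMap.charpoly.roots, z ^ p ^ n = μ ∧ z ≠ 0 := by
    intro z hz
    have hev : Module.End.HasEigenvalue ψ.toLinearMap z := by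
      rw [Module.End.hasEigenvalue_iff_isRoot_charpoly]
      exact Polynomial.isRoot_of_mem_roots hz
    obtain ⟨v, hv⟩ := hev.exists_hasEigenvector
    have hpow : ∀ j : ℕ, (((ψ.toLinearMap ^ p ^ n) - algebraMap k (Module.End k P) μ) ^ j) v =
        (z ^ p ^ n - μ) ^ j • v := by
      intro j
      induction j with
      | zero => simp
      | succ j ih =>
        rw [pow_succ', Module.End.mul_apply, ih, map_smul, LinearMap.sub_apply, hv.pow_apply,
          Module.algebraMap_end_apply, ← sub_smul, ← mul_smul, ← pow_succ]
    constructor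
    · have h0 := hpow m
      rw [hμ, LinearMap.zero_apply, eq_comm, smul_eq_zero] at h0
      exact sub_eq_zero.mp (eq_zero_of_pow_eq_zero (h0.resolve_right hv.2))
    · rintro rfl
      have h0 := hv.apply_eq_smul
      rw [zero_smul] at h0
      exact hv.2 (ψ.map_eq_zero_iff.mp h0)
  have hsplits := IsAlgClosed.splits ψ.toLinearMap.charpoly
  have hcard : ψ.toLinearMap.charpoly.roots.card = Module.finrank k P := by
    rw [← hsplits.natDegree_eq_card_roots, LinearMap.charpoly_natDegree]
  obtain ⟨z, hz⟩ := Multiset.card_pos_iff_exists_mem.mp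
    (hcard ▸ Module.finrank_pos (R := k) (M := P))
  rw [← hcard]
  refine Multiset.prime_dvd_card_of_sum_eq_zero hp hn ?_ _ (fun w hw => (hroots w hw).1) ?_
  · rw [← (hroots z hz).1]
    exact pow_ne_zero _ (hroots z hz).2
  · rw [← Module.End.trace_eq_sum_roots_charpoly_of_splits hsplits, htr]
end

section
/- Let H be a non-semisimple Hopf algebra of dimension 4p over an algebraically closed field k of characteristic zero, p an odd prime. If p divides the order of the group G(H) of group-like elements, then H is pointed. -/
open scoped TensorProduct

section RootsOfUnityTraces

open Module Polynomial

/-- A vanishing integral combination of the powers `1, ω, …, ω ^ (p - 1)` of a primitive `p`-th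
root of unity has constant coefficients. -/
lemma IsPrimitiveRoot.coeff_eq_of_sum_mul_pow_eq_zero {k : Type*} [Field k] [CharZero k] {p : ℕ}
    (hp : p.Prime) {ω : k} (hω : IsPrimitiveRoot ω p) (m : ℕ → ℤ)
    (h : ∑ i ∈ Finset.range p, (m i : k) * ω ^ i = 0) {i : ℕ} (hi : i < p) : m i = m (p - 1) := by
  have hpos := hp.pos
  have hdeg : (minpoly ℚ ω).natDegree = p - 1 := by
    rw [← cyclotomic_eq_minpoly_rat hω hpos, natDegree_cyclotomic, Nat.totient_prime hp]
  have hli : LinearIndependent ℚ (fun j : Fin (p - 1) ↦ ω ^ (j : ℕ)) := by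
    rw [← hdeg]; exact linearIndependent_pow ω
  have hgeom : ∑ j ∈ Finset.range p, ω ^ j = 0 := hω.geom_sum_eq_zero hp.one_lt
  obtain ⟨q, rfl⟩ : ∃ q, p = q + 1 := ⟨p - 1, by omega⟩
  rw [Nat.add_sub_cancel] at *
  rw [Finset.sum_range_succ] at hgeom h
  have hq : ω ^ q = -∑ j ∈ Finset.range q, ω ^ j := by linear_combination hgeom
  have hsum : ∑ j ∈ Finset.range q, ((m j : ℚ) - m q) • ω ^ j = 0 := by
    rw [← h, hq]
    simp only [Algebra.smul_def, map_sub, map_intCast, sub_mul, Finset.sum_sub_distrib,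
      ← Finset.mul_sum]
    ring
  rcases Nat.lt_succ_iff_lt_or_eq.mp hi with hlt | rfl
  · rw [Finset.sum_range] at hsum
    have := Fintype.linearIndependent_iff.mp hli (fun j ↦ (m j : ℚ) - m q) hsum ⟨i, hlt⟩
    exact_mod_cast sub_eq_zero.mp this
  · rfl

variable {k V : Type*} [Field k] [IsAlgClosed k] [CharZero k] [AddCommGroup V] [Module k V]
  [FiniteDimensional k V]

/-- An endomorphism of order dividing `p` decomposes the space into eigenspaces, so its trace is
a sum of powers of a primitive `p`-th root of unity weighted by the eigenspace dimensions. -/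
lemma Module.End.trace_eq_sum_finrank_eigenspace {p : ℕ} (hp : 0 < p) {ω : k}
    (hω : IsPrimitiveRoot ω p) {T : End k V} (hT : T ^ p = 1) :
    LinearMap.trace k V T
        = ∑ i ∈ Finset.range p, (finrank k (T.eigenspace (ω ^ i)) : k) * ω ^ i ∧
      finrank k V = ∑ i ∈ Finset.range p, finrank k (T.eigenspace (ω ^ i)) := by
  have hpk : (p : k) ≠ 0 := by exact_mod_cast hp.ne'
  have hss : T.IsSemisimple := by
    refine End.isSemisimple_of_squarefree_aeval_eq_zero (p := (X ^ p - 1 : k[X])) ?_ (by simp [hT])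
    exact ((X_pow_sub_one_separable_iff).mpr hpk).squarefree
  have htop : ⨆ μ, T.eigenspace μ = ⊤ := by
    rw [← End.iSup_maxGenEigenspace_eq_top T]
    exact iSup_congr fun μ ↦ (hss.isFinitelySemisimple.maxGenEigenspace_eq_eigenspace μ).symm
  have hinj : Function.Injective (fun i : Fin p ↦ ω ^ (i : ℕ)) := fun i j hij ↦
    Fin.ext (hω.pow_inj i.2 j.2 hij)
  have hroot : ∀ μ, T.eigenspace μ ≠ ⊥ → ∃ i : Fin p, ω ^ (i : ℕ) = μ := by
    intro μ hμ
    obtain ⟨v, hv⟩ := (show T.HasEigenvalue μ from hμ).exists_hasEigenvector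
    have h1 : (T ^ p) v = μ ^ p • v := hv.pow_apply p
    rw [hT, End.one_apply] at h1
    have h2 : (μ ^ p - 1) • v = 0 := by rw [sub_smul, ← h1, one_smul, sub_self]
    have h3 : μ ^ p = 1 := sub_eq_zero.mp ((smul_eq_zero.mp h2).resolve_right hv.2)
    have : NeZero p := ⟨hp.ne'⟩
    obtain ⟨i, hi, rfl⟩ := hω.eq_pow_of_pow_eq_one h3
    exact ⟨⟨i, hi⟩, rfl⟩
  have hint : DirectSum.IsInternal (fun i : Fin p ↦ T.eigenspace (ω ^ (i : ℕ))) := by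
    refine DirectSum.isInternal_submodule_of_iSupIndep_of_iSup_eq_top
      ((End.eigenspaces_iSupIndep T).comp hinj) (top_unique ?_)
    rw [← htop]
    refine iSup_le fun μ ↦ ?_
    by_cases hμ : T.eigenspace μ = ⊥
    · simp [hμ]
    · obtain ⟨i, rfl⟩ := hroot μ hμ
      exact le_iSup (fun i : Fin p ↦ T.eigenspace (ω ^ (i : ℕ))) i
  have hmaps : ∀ μ, Set.MapsTo T (T.eigenspace μ) (T.eigenspace μ) := fun μ v hv ↦ by
    have hv' : T v = μ • v := End.mem_eigenspace_iff.mp hv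
    rw [hv']
    exact Submodule.smul_mem _ _ hv
  constructor
  · rw [LinearMap.trace_eq_sum_trace_restrict hint (fun i ↦ hmaps _), Finset.sum_range]
    refine Finset.sum_congr rfl fun i _ ↦ ?_
    have : T.restrict (hmaps (ω ^ (i : ℕ))) = (ω ^ (i : ℕ)) • LinearMap.id := by
      ext v
      exact End.mem_eigenspace_iff.mp v.2
    rw [this, map_smul, LinearMap.trace_id, smul_eq_mul, mul_comm]
  · rw [Finset.sum_range, ← (LinearEquiv.ofBijective
      (DirectSum.coeLinearMap fun i : Fin p ↦ T.eigenspace (ω ^ (i : ℕ))) hint).finrank_eq,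
      Module.finrank_directSum]

lemma IsAlgClosed.exists_isPrimitiveRoot (k : Type*) [Field k] [IsAlgClosed k] [CharZero k] {p : ℕ}
    (hp : 0 < p) : ∃ ω : k, IsPrimitiveRoot ω p := by
  have : NeZero ((p : ℕ) : k) := ⟨by exact_mod_cast hp.ne'⟩
  exact HasEnoughRootsOfUnity.exists_primitiveRoot k p

lemma Module.End.dvd_finrank_of_trace_eq_zero {p : ℕ} (hp : p.Prime) {T : End k V}
    (hT : T ^ p = 1) (htr : LinearMap.trace k V T = 0) : p ∣ finrank k V := by
  obtain ⟨ω, hω⟩ := IsAlgClosed.exists_isPrimitiveRoot k hp.pos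
  obtain ⟨h1, h2⟩ := Module.End.trace_eq_sum_finrank_eigenspace hp.pos hω hT
  rw [htr] at h1
  have h3 := fun i hi ↦ hω.coeff_eq_of_sum_mul_pow_eq_zero hp
    (fun i ↦ (finrank k (T.eigenspace (ω ^ i)) : ℤ)) (by simpa using h1.symm) (i := i) hi
  rw [h2, Finset.sum_congr rfl fun i hi ↦
    Nat.cast_injective (h3 i (Finset.mem_range.mp hi)), Finset.sum_const, Finset.card_range]
  exact dvd_mul_right _ _

lemma Module.End.eq_one_of_trace_eq_finrank {p : ℕ} (hp : p.Prime) {T : End k V}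
    (hT : T ^ p = 1) (htr : LinearMap.trace k V T = finrank k V) : T = 1 := by
  obtain ⟨ω, hω⟩ := IsAlgClosed.exists_isPrimitiveRoot k hp.pos
  obtain ⟨h1, h2⟩ := Module.End.trace_eq_sum_finrank_eigenspace hp.pos hω hT
  set n : ℕ → ℤ := fun i ↦ finrank k (T.eigenspace (ω ^ i)) with hn
  have h3 := hω.coeff_eq_of_sum_mul_pow_eq_zero hp
    (fun i ↦ n i - if i = 0 then (finrank k V : ℤ) else 0) (by
      simp only [Int.cast_sub, sub_mul, Finset.sum_sub_distrib]
      simp [hn, hp.pos, ← h1, htr]) (i := 0) hp.pos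
  have hp1 : p - 1 ≠ 0 := by have := hp.two_le; omega
  simp only [if_true, hp1, if_false, sub_zero] at h3
  have hle : finrank k (T.eigenspace (ω ^ 0)) ≤ finrank k V := Submodule.finrank_le _
  have heq : finrank k (T.eigenspace (ω ^ 0)) = finrank k V := by
    simp only [hn] at h3
    omega
  have htop := Submodule.eq_top_of_finrank_eq heq
  ext v
  have hv : v ∈ T.eigenspace (ω ^ 0) := htop ▸ Submodule.mem_top
  simpa using End.mem_eigenspace_iff.mp hv

end RootsOfUnityTraces
section InnerAutomorphisms

open Module

universe u

variable {k A : Type u} [Field k] [Ring A] [Algebra k A]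

/-- Over an algebraically closed field, automorphisms of finite-dimensional simple algebras
are inner. -/
lemma AlgEquiv.exists_eq_conj_of_isSimpleRing [IsAlgClosed k] [IsSimpleRing A]
    [FiniteDimensional k A] (σ : A ≃ₐ[k] A) : ∃ u : Aˣ, ∀ x, σ x = u * x * (u⁻¹ : Aˣ) := by
  obtain ⟨n, hn, ⟨e₀⟩⟩ := IsSimpleRing.exists_algEquiv_matrix_of_isAlgClosed k A
  let e : A ≃ₐ[k] End k (Fin n → k) := e₀.trans Matrix.toLinAlgEquiv'
  obtain ⟨T, hT⟩ := AlgEquiv.eq_linearEquivConjAlgEquiv ((e.symm.trans σ).trans e)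
  let v : (End k (Fin n → k))ˣ :=
    ⟨T.toLinearMap, T.symm.toLinearMap, T.comp_symm, T.symm_comp⟩
  refine ⟨Units.map (e.symm : _ →* A) v, fun x ↦ e.injective ?_⟩
  have h := congrArg (fun f ↦ f (e x)) hT
  simp only [AlgEquiv.trans_apply, AlgEquiv.symm_apply_apply] at h
  rw [h, LinearEquiv.conjAlgEquiv_apply]
  simp [v, Module.End.mul_eq_comp, LinearMap.comp_assoc]

lemma IsSimpleRing.isCentral_of_isAlgClosed [IsAlgClosed k] [IsSimpleRing A]
    [FiniteDimensional k A] : Algebra.IsCentral k A := by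
  obtain ⟨n, hn, ⟨e⟩⟩ := IsSimpleRing.exists_algEquiv_matrix_of_isAlgClosed k A
  exact Algebra.IsCentral.of_algEquiv k _ _ e.symm

lemma LinearMap.trace_eq_zero_of_mul_mulLeft_eq_smul (u : Aˣ) {ζ : k} (hζ : ζ ≠ 1)
    {T : A →ₗ[k] A} (hT : ∀ x, T (u * x) = ζ • (u * T x)) : LinearMap.trace k A T = 0 := by
  have h1 : T * LinearMap.mulLeft k (u : A) = ζ • (LinearMap.mulLeft k (u : A) * T) :=
    LinearMap.ext fun x ↦ hT x
  have h2 : LinearMap.mulLeft k (u : A) * LinearMap.mulLeft k ((u⁻¹ : Aˣ) : A) = 1 := by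
    ext x; simp
  have h3 : LinearMap.mulLeft k ((u⁻¹ : Aˣ) : A) * LinearMap.mulLeft k (u : A) = 1 := by
    ext x; simp
  have h4 : LinearMap.trace k A T = ζ * LinearMap.trace k A T := by
    conv_lhs => rw [← mul_one T, ← h2, ← mul_assoc, h1, LinearMap.trace_mul_comm,
      mul_smul_comm, ← mul_assoc, h3, one_mul, map_smul, smul_eq_mul]
  have h5 : (1 - ζ) * LinearMap.trace k A T = 0 := by linear_combination h4
  exact (mul_eq_zero.mp h5).resolve_left (sub_ne_zero.mpr hζ.symm)

/-- A three-dimensional subspace of an algebra, containing `1` and a non-scalar element which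
commutes with the whole subspace, is commutative. -/
lemma Submodule.commute_of_finrank_eq_three {R : Submodule k A} [FiniteDimensional k A]
    (h3 : finrank k R = 3) (h1 : (1 : A) ∈ R) {b : A} (hb : b ∈ R)
    (hli : LinearIndependent k ![1, b]) (hcomm : ∀ x ∈ R, b * x = x * b) {x y : A} (hx : x ∈ R)
    (hy : y ∈ R) : x * y = y * x := by
  set W : Submodule k A := span k (Set.range ![1, b]) with hW
  have hW2 : finrank k W = 2 := by simpa using finrank_span_eq_card hli
  have hWR : W ≤ R := by
    rw [hW, span_le]
    rintro _ ⟨i, rfl⟩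
    fin_cases i
    · exact h1
    · exact hb
  have hWc : ∀ w ∈ W, ∀ z ∈ R, w * z = z * w := by
    intro w hw z hz
    induction hw using Submodule.span_induction with
    | mem w hw =>
      obtain ⟨i, rfl⟩ := hw
      fin_cases i
      · simp
      · exact hcomm z hz
    | zero => simp
    | add u v _ _ hu hv => rw [add_mul, mul_add, hu, hv]
    | smul c u _ hu => rw [smul_mul_assoc, mul_smul_comm, hu]
  have hlt : W < R := lt_of_le_of_ne hWR fun h ↦ by rw [h, h3] at hW2; omega
  obtain ⟨z, hzR, hzW⟩ := SetLike.exists_of_lt hlt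
  have hsup : W ⊔ span k {z} = R := by
    refine eq_of_le_of_finrank_le (sup_le hWR (by simpa using hzR)) ?_
    have : finrank k W < finrank k ↥(W ⊔ span k {z}) :=
      finrank_lt_finrank_of_lt (lt_of_le_of_ne le_sup_left fun h ↦
        hzW (h ▸ mem_sup_right (mem_span_singleton_self z)))
    omega
  rw [← hsup] at hx hy
  obtain ⟨u, hu, u', hu', rfl⟩ := mem_sup.mp hx
  obtain ⟨v, hv, v', hv', rfl⟩ := mem_sup.mp hy
  obtain ⟨c, rfl⟩ := mem_span_singleton.mp hu'
  obtain ⟨d, rfl⟩ := mem_span_singleton.mp hv'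
  have e1 := hWc u hu v (hWR hv)
  have e2 := hWc u hu z hzR
  have e3 := hWc v hv z hzR
  simp only [add_mul, mul_add, smul_mul_assoc, mul_smul_comm, smul_add, e1, e2, e3,
    smul_comm c d (z * z)]
  abel

/-- If `σ`, `τ` are commuting automorphisms of a nine-dimensional simple algebra, `σ ^ 3 = 1`
and the regular trace conditions `Tr σ = Tr σ² = 0` hold, then `Tr (τ (1 + σ + σ²))` is `0`
or `9`. -/
lemma AlgEquiv.trace_comp_average_eq_zero_or_nine [IsAlgClosed k] [CharZero k]
    [IsSimpleRing A] [FiniteDimensional k A] (h9 : finrank k A = 9) {σ τ : A ≃ₐ[k] A}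
    (hcomm : ∀ x, σ (τ x) = τ (σ x)) (hσ : ∀ x, σ (σ (σ x)) = x)
    (h1 : LinearMap.trace k A σ.toLinearMap = 0)
    (h2 : LinearMap.trace k A (σ.toLinearMap ∘ₗ σ.toLinearMap) = 0) {T : A →ₗ[k] A}
    (hT : ∀ x, T x = τ (x + σ x + σ (σ x))) :
    LinearMap.trace k A T = 0 ∨ LinearMap.trace k A T = 9 := by
  obtain ⟨b, hb⟩ := σ.exists_eq_conj_of_isSimpleRing
  obtain ⟨a, ha⟩ := τ.exists_eq_conj_of_isSimpleRing
  have hcent := IsSimpleRing.isCentral_of_isAlgClosed (k := k) (A := A)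
  have hσb : σ b = b := by rw [hb]; simp
  obtain ⟨ζ, hζ⟩ : ∃ ζ : k, τ b = ζ • (b : A) := by
    have hc : ((b⁻¹ : Aˣ) : A) * τ b ∈ Subalgebra.center k A := by
      rw [Subalgebra.mem_center_iff]
      intro y
      obtain ⟨x, rfl⟩ := τ.surjective y
      have h := hcomm x
      rw [hb, hb, map_mul, map_mul] at h
      have h' : τ ((b⁻¹ : Aˣ) : A) * τ b = 1 := by rw [← map_mul]; simp
      have h'' : (b : A) * τ x * ((b⁻¹ : Aˣ) : A) * τ b = τ b * τ x := by
        rw [h, mul_assoc, h', mul_one]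
      calc τ x * (((b⁻¹ : Aˣ) : A) * τ b)
          = ((b⁻¹ : Aˣ) : A) * ((b : A) * τ x * ((b⁻¹ : Aˣ) : A) * τ b) := by
            simp [← mul_assoc]
        _ = _ := by rw [h'', mul_assoc]
    obtain ⟨ζ, h⟩ := (Algebra.IsCentral.mem_center_iff k).mp hc
    refine ⟨ζ, ?_⟩
    have := congrArg (fun z ↦ (b : A) * z) h
    simpa [← mul_assoc, Algebra.smul_def, Algebra.commutes] using this
  by_cases hζ1 : ζ = 1
  · right
    subst hζ1
    rw [one_smul, ha] at hζ
    have hab : (a : A) * b = b * a := by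
      have := congrArg (fun z ↦ z * (a : A)) hζ
      simpa [mul_assoc] using this
    have h3 : (3 : k) ≠ 0 := by norm_num
    let E : A →ₗ[k] A := (3 : k)⁻¹ •
      (LinearMap.id + σ.toLinearMap + σ.toLinearMap ∘ₗ σ.toLinearMap)
    let R : Submodule k A := LinearMap.eqLocus σ.toLinearMap LinearMap.id
    have hR : ∀ x, x ∈ R ↔ σ x = x := fun x ↦ Iff.rfl
    have hE : ∀ x, E x = (3 : k)⁻¹ • (x + σ x + σ (σ x)) := fun x ↦ rfl
    have htrE : LinearMap.trace k A E = 3 := by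
      simp only [E, map_smul, map_add, h1, h2, LinearMap.trace_id, h9]
      norm_num
    have hproj : LinearMap.IsProj R E := by
      refine ⟨fun x ↦ ?_, fun x hx ↦ ?_⟩
      · rw [hR, hE, map_smul, map_add, map_add, hσ]
        congr 1
        abel
      · rw [hR] at hx
        rw [hE, hx, hx, inv_smul_eq_iff₀ h3, ← one_smul k x, ← add_smul, ← add_smul, smul_smul]
        norm_num
    have hfr : finrank k R = 3 := by
      have := hproj.trace
      rw [htrE] at this
      exact_mod_cast this.symm
    have hbR : ∀ x ∈ R, (b : A) * x = x * b := by
      intro x hx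
      rw [hR, hb] at hx
      have := congrArg (fun z ↦ z * (b : A)) hx
      simpa [mul_assoc] using this
    have hli : LinearIndependent k ![1, (b : A)] := by
      rw [LinearIndependent.pair_iff' one_ne_zero]
      intro c hc
      have : σ.toLinearMap = LinearMap.id := by
        ext x
        change σ x = x
        rw [hb, ← hc, smul_mul_assoc, one_mul, ← mul_one x, ← mul_smul_comm, hc]
        simp
      rw [this, LinearMap.trace_id, h9] at h1
      norm_num at h1
    have haR : (a : A) ∈ R := by
      rw [hR, hb, ← hab]
      simp
    have hfix : ∀ x ∈ R, τ x = x := by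
      intro x hx
      rw [ha, Submodule.commute_of_finrank_eq_three hfr (by rw [hR, map_one]) (by rw [hR, hσb])
        hli hbR haR hx]
      simp
    have hTE : T = (3 : k) • E := by
      ext x
      have := hfix _ (hproj.map_mem x)
      rw [LinearMap.smul_apply, ← this, hE, map_smul, smul_smul, mul_inv_cancel₀ h3, one_smul, hT]
    rw [hTE, map_smul, htrE, smul_eq_mul]
    norm_num
  · left
    refine LinearMap.trace_eq_zero_of_mul_mulLeft_eq_smul b hζ1 fun x ↦ ?_
    rw [hT, hT]
    simp only [map_mul, hσb, hζ, map_add, mul_add, smul_add, smul_mul_assoc]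

end InnerAutomorphisms

section Subcoalgebras

open Module

section Slices

variable {k V W : Type*} [Field k] [AddCommGroup V] [Module k V] [AddCommGroup W] [Module k W]

lemma TensorProduct.eq_zero_of_forall_lTensor {x : V ⊗[k] W}
    (h : ∀ f : Dual k W, TensorProduct.rid k V (f.lTensor V x) = 0) : x = 0 := by
  classical
  let b := Basis.ofVectorSpace k W
  refine (TensorProduct.equivFinsuppOfBasisRight (M := V) b).injective (Finsupp.ext fun j ↦ ?_)
  rw [map_zero, Finsupp.zero_apply, ← h (b.coord j),
    TensorProduct.equivFinsuppOfBasisRight_apply]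

lemma TensorProduct.eq_zero_of_forall_rTensor {x : V ⊗[k] W}
    (h : ∀ f : Dual k V, TensorProduct.lid k W (f.rTensor W x) = 0) : x = 0 := by
  classical
  let b := Basis.ofVectorSpace k V
  refine (TensorProduct.equivFinsuppOfBasisLeft (N := W) b).injective (Finsupp.ext fun j ↦ ?_)
  rw [map_zero, Finsupp.zero_apply, ← h (b.coord j),
    TensorProduct.equivFinsuppOfBasisLeft_apply]

lemma TensorProduct.rid_lTensor_rTensor (φ : V →ₗ[k] V) (f : Dual k W) (x : V ⊗[k] W) :
    TensorProduct.rid k V (f.lTensor V (φ.rTensor W x)) =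
      φ (TensorProduct.rid k V (f.lTensor V x)) := by
  induction x with
  | zero => simp
  | tmul v w => simp
  | add x y hx hy => simp only [map_add, hx, hy]

lemma TensorProduct.lid_rTensor_lTensor (φ : W →ₗ[k] W) (f : Dual k V) (x : V ⊗[k] W) :
    TensorProduct.lid k W (f.rTensor W (φ.lTensor V x)) =
      φ (TensorProduct.lid k W (f.rTensor W x)) := by
  induction x with
  | zero => simp
  | tmul v w => simp
  | add x y hx hy => simp only [map_add, hx, hy]

lemma TensorProduct.mem_range_map_subtype_iff {D : Submodule k V} {x : V ⊗[k] V} :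
    x ∈ LinearMap.range (TensorProduct.map D.subtype D.subtype) ↔
      ∀ f : Dual k V, TensorProduct.rid k V (f.lTensor V x) ∈ D ∧
        TensorProduct.lid k V (f.rTensor V x) ∈ D := by
  constructor
  · rintro ⟨y, rfl⟩ f
    induction y with
    | zero => simp
    | tmul v w => simpa using ⟨D.smul_mem _ v.2, D.smul_mem _ w.2⟩
    | add x y hx hy =>
      simp only [map_add]
      exact ⟨D.add_mem hx.1 hy.1, D.add_mem hx.2 hy.2⟩
  · intro h
    obtain ⟨r, hr⟩ := D.subtype.exists_leftInverse_of_injective D.ker_subtype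
    have hP : ∀ v ∈ D, (D.subtype ∘ₗ r) v = v := fun v hv ↦
      congrArg Subtype.val (LinearMap.congr_fun hr ⟨v, hv⟩)
    have h1 : (D.subtype ∘ₗ r).rTensor V x = x := by
      rw [← sub_eq_zero]
      refine TensorProduct.eq_zero_of_forall_lTensor fun f ↦ ?_
      rw [map_sub, map_sub, TensorProduct.rid_lTensor_rTensor, hP _ (h f).1, sub_self]
    have h2 : (D.subtype ∘ₗ r).lTensor V x = x := by
      rw [← sub_eq_zero]
      refine TensorProduct.eq_zero_of_forall_rTensor fun f ↦ ?_
      rw [map_sub, map_sub, TensorProduct.lid_rTensor_lTensor, hP _ (h f).2, sub_self]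
    refine ⟨TensorProduct.map r r x, ?_⟩
    conv_rhs => rw [← h1, ← h2]
    rw [← LinearMap.comp_apply, ← LinearMap.comp_apply, ← TensorProduct.map_comp,
      LinearMap.rTensor_comp_lTensor]

end Slices

variable {k H : Type} [Field k] [AddCommGroup H] [Module k H] [Coalgebra k H]

/-- The map `x ↦ x₁ f(x₂)`. -/
noncomputable def Coalgebra.sliceRight (f : Dual k H) : H →ₗ[k] H :=
  (_root_.TensorProduct.rid k H).toLinearMap ∘ₗ f.lTensor H ∘ₗ Coalgebra.comul

/-- The map `x ↦ f(x₁) x₂`. -/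
noncomputable def Coalgebra.sliceLeft (f : Dual k H) : H →ₗ[k] H :=
  (_root_.TensorProduct.lid k H).toLinearMap ∘ₗ f.rTensor H ∘ₗ Coalgebra.comul

open Coalgebra

lemma Coalgebra.sliceRight_counit (x : H) : sliceRight (counit (R := k)) x = x := by
  simp [sliceRight]

lemma Coalgebra.sliceLeft_counit (x : H) : sliceLeft (counit (R := k)) x = x := by
  simp [sliceLeft]

lemma Coalgebra.Repr.sliceRight (f : Dual k H) {x : H} {ι : Type*}
    (r : Coalgebra.Repr k x ι) :
    Coalgebra.sliceRight f x = ∑ i ∈ r.index, f (r.right i) • r.left i := by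
  simp [Coalgebra.sliceRight, ← r.eq]

lemma Coalgebra.Repr.sliceLeft (f : Dual k H) {x : H} {ι : Type*}
    (r : Coalgebra.Repr k x ι) :
    Coalgebra.sliceLeft f x = ∑ i ∈ r.index, f (r.left i) • r.right i := by
  simp [Coalgebra.sliceLeft, ← r.eq]

lemma isSubcoalgebraOf_iff {D : Submodule k H} :
    IsSubcoalgebraOf (comul (R := k) (A := H)) D ↔
      ∀ (f : Dual k H), ∀ c ∈ D, sliceRight f c ∈ D ∧ sliceLeft f c ∈ D :=
  ⟨fun h f c hc ↦ TensorProduct.mem_range_map_subtype_iff.mp (h c hc) f,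
    fun h c hc ↦ TensorProduct.mem_range_map_subtype_iff.mpr fun f ↦ h f c hc⟩

namespace IsSubcoalgebraOf

lemma bot : IsSubcoalgebraOf (comul (R := k) (A := H)) ⊥ := by
  rw [isSubcoalgebraOf_iff]
  simp

lemma inf {D E : Submodule k H} (hD : IsSubcoalgebraOf (comul (R := k) (A := H)) D)
    (hE : IsSubcoalgebraOf (comul (R := k) (A := H)) E) :
    IsSubcoalgebraOf (comul (R := k) (A := H)) (D ⊓ E) := by
  rw [isSubcoalgebraOf_iff] at *
  exact fun f c hc ↦ ⟨⟨(hD f c hc.1).1, (hE f c hc.2).1⟩, ⟨(hD f c hc.1).2, (hE f c hc.2).2⟩⟩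

lemma sup {D E : Submodule k H} (hD : IsSubcoalgebraOf (comul (R := k) (A := H)) D)
    (hE : IsSubcoalgebraOf (comul (R := k) (A := H)) E) :
    IsSubcoalgebraOf (comul (R := k) (A := H)) (D ⊔ E) := by
  rw [isSubcoalgebraOf_iff] at *
  intro f c hc
  obtain ⟨d, hd, e, he, rfl⟩ := Submodule.mem_sup.mp hc
  rw [map_add, map_add]
  exact ⟨Submodule.add_mem_sup (hD f d hd).1 (hE f e he).1,
    Submodule.add_mem_sup (hD f d hd).2 (hE f e he).2⟩

lemma map {D : Submodule k H} (hD : IsSubcoalgebraOf (comul (R := k) (A := H)) D)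
    {φ : H →ₗ[k] H} (hφ : ∀ x, comul (R := k) (φ x) = TensorProduct.map φ φ (comul x)) :
    IsSubcoalgebraOf (comul (R := k) (A := H)) (D.map φ) := by
  rintro _ ⟨c, hc, rfl⟩
  obtain ⟨y, hy⟩ := hD c hc
  refine ⟨TensorProduct.map (φ.submoduleMap D) (φ.submoduleMap D) y, ?_⟩
  rw [hφ, ← hy, ← LinearMap.comp_apply, ← LinearMap.comp_apply, ← TensorProduct.map_comp,
    ← TensorProduct.map_comp]
  rfl

lemma span_singleton {g : H} (hg : IsGroupLikeOf (comul (R := k) (A := H)) g) :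
    IsSubcoalgebraOf (comul (R := k) (A := H)) (Submodule.span k {g}) := by
  rw [isSubcoalgebraOf_iff]
  intro f c hc
  obtain ⟨a, rfl⟩ := Submodule.mem_span_singleton.mp hc
  have h1 := Submodule.mem_span_singleton_self (R := k) g
  simp only [map_smul]
  constructor <;> refine Submodule.smul_mem _ _ ?_
  · simpa [sliceRight, hg.2] using Submodule.smul_mem _ _ h1
  · simpa [sliceLeft, hg.2] using Submodule.smul_mem _ _ h1

/-- A subcoalgebra of `D + E` meeting `D` trivially is contained in `E`. -/
lemma le_right_of_le_sup {X D E : Submodule k H}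
    (hX : IsSubcoalgebraOf (comul (R := k) (A := H)) X)
    (hD : IsSubcoalgebraOf (comul (R := k) (A := H)) D)
    (hE : IsSubcoalgebraOf (comul (R := k) (A := H)) E) (hle : X ≤ D ⊔ E) (hXD : X ⊓ D = ⊥) :
    X ≤ E := by
  obtain ⟨D', hDD', hXD'⟩ : ∃ D', D ≤ D' ∧ IsCompl X D' := by
    obtain ⟨D', h, h'⟩ := (disjoint_iff.mpr hXD).symm.exists_isCompl
    exact ⟨D', h, h'.symm⟩
  let f : Dual k H := (counit (R := k)) ∘ₗ X.subtype ∘ₗ X.projectionOnto D' hXD'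
  have hfD : ∀ d ∈ D, f d = 0 := fun d hd ↦ by
    simp [f, Submodule.projectionOnto_apply_right hXD' ⟨d, hDD' hd⟩]
  have hfX : ∀ x ∈ X, f x = counit (R := k) x := fun x hx ↦ by
    simp [f, Submodule.projectionOnto_apply_left hXD' ⟨x, hx⟩]
  have key : ∀ {Y : Submodule k H}, IsSubcoalgebraOf (comul (R := k) (A := H)) Y →
      ∀ (f₁ f₂ : Dual k H), (∀ y ∈ Y, f₁ y = f₂ y) → ∀ y ∈ Y,
        sliceRight f₁ y = sliceRight f₂ y := by
    intro Y hY f₁ f₂ hf y hy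
    obtain ⟨z, hz⟩ := hY y hy
    simp only [sliceRight, LinearMap.comp_apply, ← hz]
    congr 1
    rw [← LinearMap.comp_apply, ← LinearMap.comp_apply, LinearMap.lTensor_comp_map,
      LinearMap.lTensor_comp_map]
    congr 2
    exact LinearMap.ext fun y ↦ hf y y.2
  intro x hx
  obtain ⟨d, hd, e, he, hde⟩ := Submodule.mem_sup.mp (hle hx)
  have h1 : sliceRight f x = x := by
    rw [key hX f (counit (R := k)) hfX x hx, sliceRight_counit]
  have h2 : sliceRight f d = 0 := by
    rw [key hD f 0 hfD d hd]
    simp [sliceRight]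
  rw [← h1, ← hde, map_add, h2, zero_add]
  exact (isSubcoalgebraOf_iff.mp hE f e he).1

end IsSubcoalgebraOf

namespace IsSimpleSubcoalgebraOf

lemma le_of_inf_ne_bot {C D : Submodule k H}
    (hC : IsSimpleSubcoalgebraOf (comul (R := k) (A := H)) C)
    (hD : IsSubcoalgebraOf (comul (R := k) (A := H)) D) (h : C ⊓ D ≠ ⊥) : C ≤ D :=
  inf_eq_left.mp ((hC.2.2 _ (hC.1.inf hD) inf_le_left).resolve_left h)

lemma eq_of_le {C D : Submodule k H}
    (hC : IsSimpleSubcoalgebraOf (comul (R := k) (A := H)) C)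
    (hD : IsSimpleSubcoalgebraOf (comul (R := k) (A := H)) D) (h : C ≤ D) : C = D :=
  (hD.2.2 C hC.1 h).resolve_left hC.2.1

lemma span_singleton {g : H} (hg : IsGroupLikeOf (comul (R := k) (A := H)) g) :
    IsSimpleSubcoalgebraOf (comul (R := k) (A := H)) (Submodule.span k {g}) := by
  refine ⟨.span_singleton hg, by simpa using hg.1, fun D _ hle ↦ ?_⟩
  exact ((nonzero_span_atom g hg.1).le_iff).mp hle

lemma exists_mem_le_of_le_sup {C : Submodule k H}
    (hC : IsSimpleSubcoalgebraOf (comul (R := k) (A := H)) C) {s : Finset (Submodule k H)}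
    (hs : ∀ D ∈ s, IsSimpleSubcoalgebraOf (comul (R := k) (A := H)) D)
    (hle : C ≤ s.sup id) : C ∈ s := by
  classical
  have hsup : ∀ t : Finset (Submodule k H),
      (∀ D ∈ t, IsSimpleSubcoalgebraOf (comul (R := k) (A := H)) D) →
      IsSubcoalgebraOf (comul (R := k) (A := H)) (t.sup id) := fun t ht ↦
    Finset.sup_induction .bot (fun _ h₁ _ h₂ ↦ h₁.sup h₂) fun D hD ↦ (ht D hD).1
  induction s using Finset.induction_on with
  | empty => exact absurd (le_bot_iff.mp hle) hC.2.1
  | insert D t _ ih =>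
    rw [Finset.sup_insert, id] at hle
    have ht : ∀ E ∈ t, IsSimpleSubcoalgebraOf (comul (R := k) (A := H)) E := fun E hE ↦
      hs E (Finset.mem_insert_of_mem hE)
    have hD := hs D (Finset.mem_insert_self D t)
    by_cases h : C ⊓ D = ⊥
    · exact Finset.mem_insert_of_mem (ih ht (hC.1.le_right_of_le_sup hD.1 (hsup t ht) hle h))
    · rw [hC.eq_of_le hD (hC.le_of_inf_ne_bot hD.1 h)]
      exact Finset.mem_insert_self D t

lemma sum_finrank_le [FiniteDimensional k H] (s : Finset (Submodule k H))
    (hs : ∀ D ∈ s, IsSimpleSubcoalgebraOf (comul (R := k) (A := H)) D) :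
    ∑ D ∈ s, finrank k D ≤ finrank k ↥(s.sup id) := by
  classical
  induction s using Finset.induction_on with
  | empty => simp
  | insert D t hDt ih =>
    have ht : ∀ E ∈ t, IsSimpleSubcoalgebraOf (comul (R := k) (A := H)) E := fun E hE ↦
      hs E (Finset.mem_insert_of_mem hE)
    have hsub : IsSubcoalgebraOf (comul (R := k) (A := H)) (t.sup id) :=
      Finset.sup_induction .bot (fun _ h₁ _ h₂ ↦ h₁.sup h₂) fun D hD ↦ (ht D hD).1
    have hD := hs D (Finset.mem_insert_self D t)
    have hbot : D ⊓ t.sup id = ⊥ := by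
      by_contra h
      exact hDt (hD.exists_mem_le_of_le_sup ht (hD.le_of_inf_ne_bot hsub h))
    rw [Finset.sum_insert hDt, Finset.sup_insert, id]
    have := Submodule.finrank_sup_add_finrank_inf_eq D (t.sup id)
    rw [hbot, finrank_bot, add_zero] at this
    have := ih ht
    omega

end IsSimpleSubcoalgebraOf

end Subcoalgebras

section DualAlgebra

open Module Coalgebra WithConv

variable {k C : Type} [Field k] [AddCommGroup C] [Module k C] [Coalgebra k C]

lemma Coalgebra.apply_sliceRight (f h : Dual k C) (c : C) :
    f (sliceRight h c) = (toConv f * toConv h).ofConv c := by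
  rw [(ℛ k c).sliceRight, (ℛ k c).convMul_apply]
  simp [mul_comm]

lemma Coalgebra.apply_sliceLeft (f h : Dual k C) (c : C) :
    f (sliceLeft h c) = (toConv h * toConv f).ofConv c := by
  rw [(ℛ k c).sliceLeft, (ℛ k c).convMul_apply]
  simp

/-- The dual algebra of a finite-dimensional simple coalgebra is simple. -/
lemma Coalgebra.isSimpleRing_dual [FiniteDimensional k C] [Nontrivial C]
    (h : ∀ D : Submodule k C, IsSubcoalgebraOf (comul (R := k) (A := C)) D → D = ⊥ ∨ D = ⊤) :
    IsSimpleRing (WithConv (C →ₗ[k] k)) := by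
  have : Nontrivial (C →ₗ[k] k) := inferInstanceAs (Nontrivial (Dual k C))
  refine .of_eq_bot_or_eq_top fun I ↦ ?_
  let W : Submodule k (Dual k C) :=
    { carrier := {f | toConv f ∈ I}
      add_mem' := fun {f g} hf hg ↦ I.add_mem hf hg
      zero_mem' := I.zero_mem
      smul_mem' := fun c f hf ↦ by
        have := I.mul_mem_left (algebraMap k _ c) _ hf
        rwa [← Algebra.smul_def] at this }
  have hW : ∀ f, f ∈ W ↔ toConv f ∈ I := fun f ↦ Iff.rfl
  have hsub : IsSubcoalgebraOf (comul (R := k) (A := C)) W.dualCoannihilator := by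
    rw [isSubcoalgebraOf_iff]
    intro f c hc
    rw [Submodule.mem_dualCoannihilator] at hc
    simp only [Submodule.mem_dualCoannihilator]
    refine ⟨fun g hg ↦ ?_, fun g hg ↦ ?_⟩
    · rw [apply_sliceRight]
      exact hc _ ((hW _).mpr (I.mul_mem_right _ _ hg))
    · rw [apply_sliceLeft]
      exact hc _ ((hW _).mpr (I.mul_mem_left _ _ hg))
  have hWW := Subspace.dualCoannihilator_dualAnnihilator_eq (W := W)
  rcases h _ hsub with h | h
  · right
    rw [h, Submodule.dualAnnihilator_bot] at hWW
    refine eq_top_iff.mpr fun f _ ↦ ?_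
    exact (hW f.ofConv).mp (hWW ▸ Submodule.mem_top)
  · left
    rw [h, Submodule.dualAnnihilator_top] at hWW
    refine eq_bot_iff.mpr fun f hf ↦ ?_
    have : f.ofConv ∈ W := hf
    rw [← hWW, Submodule.mem_bot] at this
    simpa using this

lemma IsSubcoalgebraOf.exists_comul {D : Submodule k C}
    (hD : IsSubcoalgebraOf (comul (R := k) (A := C)) D) :
    ∃ δ : D →ₗ[k] D ⊗[k] D,
      TensorProduct.map D.subtype D.subtype ∘ₗ δ = comul ∘ₗ D.subtype := by
  obtain ⟨r, hr⟩ := D.subtype.exists_leftInverse_of_injective D.ker_subtype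
  refine ⟨TensorProduct.map r r ∘ₗ comul ∘ₗ D.subtype, LinearMap.ext fun c ↦ ?_⟩
  obtain ⟨y, hy⟩ := hD c c.2
  simp only [LinearMap.comp_apply, Submodule.subtype_apply, ← hy]
  rw [← LinearMap.comp_apply (TensorProduct.map r r), ← TensorProduct.map_comp, hr,
    TensorProduct.map_id, LinearMap.id_apply]

/-- The coalgebra structure on a subcoalgebra. -/
noncomputable abbrev IsSubcoalgebraOf.coalgebra {D : Submodule k C}
    (hD : IsSubcoalgebraOf (comul (R := k) (A := C)) D) : Coalgebra k D :=
  let δ := hD.exists_comul.choose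
  have hδ : TensorProduct.map D.subtype D.subtype ∘ₗ δ = comul ∘ₗ D.subtype :=
    hD.exists_comul.choose_spec
  have hinj : Function.Injective
      (TensorProduct.map D.subtype (TensorProduct.map D.subtype D.subtype)) :=
    TensorProduct.map_injective_of_flat_flat _ _ D.subtype_injective
      (TensorProduct.map_injective_of_flat_flat _ _ D.subtype_injective D.subtype_injective)
  { comul := δ
    counit := counit ∘ₗ D.subtype
    coassoc := by
      have e₁ : TensorProduct.map D.subtype (TensorProduct.map D.subtype D.subtype) ∘ₗ
          (TensorProduct.assoc k D D D).toLinearMap =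
          (TensorProduct.assoc k C C C).toLinearMap ∘ₗ
            TensorProduct.map (TensorProduct.map D.subtype D.subtype) D.subtype := by
        ext; simp
      have e₂ : TensorProduct.map (TensorProduct.map D.subtype D.subtype) D.subtype ∘ₗ
          δ.rTensor D =
          (comul (R := k) (A := C)).rTensor C ∘ₗ TensorProduct.map D.subtype D.subtype := by
        rw [LinearMap.map_comp_rTensor, hδ, LinearMap.rTensor_comp_map]
      have e₃ : TensorProduct.map D.subtype (TensorProduct.map D.subtype D.subtype) ∘ₗ
          δ.lTensor D =
          (comul (R := k) (A := C)).lTensor C ∘ₗ TensorProduct.map D.subtype D.subtype := by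
        rw [LinearMap.map_comp_lTensor, hδ, LinearMap.lTensor_comp_map]
      refine LinearMap.ext fun x ↦ hinj ?_
      have h₁ := LinearMap.congr_fun e₁ (δ.rTensor D (δ x))
      have h₂ := LinearMap.congr_fun e₂ (δ x)
      have h₃ := LinearMap.congr_fun e₃ (δ x)
      have h₄ := LinearMap.congr_fun hδ x
      simp only [LinearMap.comp_apply, LinearEquiv.coe_coe, Submodule.subtype_apply] at *
      rw [h₁, h₂, h₃, h₄]
      exact Coalgebra.coassoc_apply (x : C)
    rTensor_counit_comp_comul := by
      refine LinearMap.cancel_left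
        (Module.Flat.lTensor_preserves_injective_linearMap (M := k) D.subtype
          D.subtype_injective) |>.mp ?_
      rw [LinearMap.rTensor_comp, LinearMap.comp_assoc, ← LinearMap.comp_assoc,
        ← LinearMap.comp_assoc]
      have : (D.subtype.lTensor k ∘ₗ (counit (R := k) (A := C)).rTensor D) ∘ₗ
          D.subtype.rTensor D = (counit (R := k) (A := C)).rTensor C ∘ₗ
            TensorProduct.map D.subtype D.subtype := by
        ext; simp
      rw [this, LinearMap.comp_assoc, hδ, ← LinearMap.comp_assoc, rTensor_counit_comp_comul]
      ext; simp
    lTensor_counit_comp_comul := by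
      refine LinearMap.cancel_left
        (Module.Flat.rTensor_preserves_injective_linearMap (M := k) D.subtype
          D.subtype_injective) |>.mp ?_
      rw [LinearMap.lTensor_comp, LinearMap.comp_assoc, ← LinearMap.comp_assoc,
        ← LinearMap.comp_assoc]
      have : (D.subtype.rTensor k ∘ₗ (counit (R := k) (A := C)).lTensor D) ∘ₗ
          D.subtype.lTensor D = (counit (R := k) (A := C)).lTensor C ∘ₗ
            TensorProduct.map D.subtype D.subtype := by
        ext; simp
      rw [this, LinearMap.comp_assoc, hδ, ← LinearMap.comp_assoc, lTensor_counit_comp_comul]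
      ext; simp }

lemma IsSubcoalgebraOf.map_subtype_comul {D : Submodule k C}
    (hD : IsSubcoalgebraOf (comul (R := k) (A := C)) D) (x : D) :
    TensorProduct.map D.subtype D.subtype (hD.coalgebra.comul x) = comul (x : C) :=
  LinearMap.congr_fun hD.exists_comul.choose_spec x

lemma IsSimpleSubcoalgebraOf.eq_bot_or_eq_top {D : Submodule k C}
    (hD : IsSimpleSubcoalgebraOf (comul (R := k) (A := C)) D) (E : Submodule k D)
    (hE : IsSubcoalgebraOf hD.1.coalgebra.comul E) : E = ⊥ ∨ E = ⊤ := by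
  have h : IsSubcoalgebraOf (comul (R := k) (A := C)) (E.map D.subtype) := by
    rintro _ ⟨c, hc, rfl⟩
    obtain ⟨y, hy⟩ := hE c hc
    refine ⟨TensorProduct.map (D.subtype.submoduleMap E) (D.subtype.submoduleMap E) y, ?_⟩
    rw [Submodule.subtype_apply, ← hD.1.map_subtype_comul, ← hy, ← LinearMap.comp_apply,
      ← LinearMap.comp_apply, ← TensorProduct.map_comp, ← TensorProduct.map_comp]
    rfl
  rcases hD.2.2 _ h (Submodule.map_subtype_le D E) with h | h
  · exact .inl ((Submodule.map_injective_of_injective D.subtype_injective)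
      (by rw [h, Submodule.map_bot]))
  · refine .inr (Submodule.map_injective_of_injective D.subtype_injective ?_)
    rw [h, Submodule.map_subtype_top]

lemma IsSimpleSubcoalgebraOf.isSimpleRing_dual {D : Submodule k C} [FiniteDimensional k C]
    (hD : IsSimpleSubcoalgebraOf (comul (R := k) (A := C)) D) :
    letI := hD.1.coalgebra
    IsSimpleRing (WithConv (D →ₗ[k] k)) :=
  letI := hD.1.coalgebra
  have : Nontrivial D := Submodule.nontrivial_iff_ne_bot.mpr hD.2.1
  Coalgebra.isSimpleRing_dual hD.eq_bot_or_eq_top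

lemma IsSimpleSubcoalgebraOf.exists_finrank_eq_mul_self [IsAlgClosed k] {D : Submodule k C}
    [FiniteDimensional k C] (hD : IsSimpleSubcoalgebraOf (comul (R := k) (A := C)) D) :
    ∃ d, finrank k D = d * d := by
  let := hD.1.coalgebra
  have := hD.isSimpleRing_dual
  have : FiniteDimensional k (WithConv (D →ₗ[k] k)) :=
    (WithConv.linearEquiv k (D →ₗ[k] k)).symm.finiteDimensional
  obtain ⟨d, -, ⟨e⟩⟩ :=
    IsSimpleRing.exists_algEquiv_matrix_of_isAlgClosed k (WithConv (D →ₗ[k] k))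
  refine ⟨d, ?_⟩
  have h := e.toLinearEquiv.finrank_eq
  rw [Module.finrank_matrix, (WithConv.linearEquiv k (D →ₗ[k] k)).finrank_eq] at h
  rw [← Subspace.dual_finrank_eq (K := k) (V := D)]
  simpa using h

/-- Precomposition with an injective endomorphism of a finite-dimensional coalgebra is an
automorphism of the dual algebra. -/
noncomputable def Coalgebra.dualAlgEquiv [FiniteDimensional k C] (φ : C →ₗc[k] C)
    (hφ : Function.Injective φ) : WithConv (C →ₗ[k] k) ≃ₐ[k] WithConv (C →ₗ[k] k) :=
  have hsurj : Function.Surjective φ :=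
    LinearMap.surjective_of_injective (f := φ.toLinearMap) hφ
  have : FiniteDimensional k (WithConv (C →ₗ[k] k)) :=
    (WithConv.linearEquiv k (C →ₗ[k] k)).symm.finiteDimensional
  let F : WithConv (C →ₗ[k] k) →ₐ[k] WithConv (C →ₗ[k] k) :=
    AlgHom.ofLinearMap
      { toFun := fun f ↦ toConv (f.ofConv ∘ₗ φ.toLinearMap)
        map_add' := fun f g ↦ rfl
        map_smul' := fun c f ↦ rfl }
      (by ext; simp)
      (fun f g ↦ by
        ext1
        exact LinearMap.convMul_comp_coalgHom_distrib f g φ)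
  have hF : Function.Injective F := fun f g h ↦ by
    ext x
    obtain ⟨y, rfl⟩ := hsurj x
    exact LinearMap.congr_fun (congrArg ofConv h) y
  AlgEquiv.ofBijective F ⟨hF, LinearMap.surjective_of_injective (f := F.toLinearMap) hF⟩

lemma LinearMap.trace_eq_trace_of_ofConv {V : Type} [AddCommGroup V] [Module k V]
    [FiniteDimensional k V]
    {T : WithConv (V →ₗ[k] k) →ₗ[k] WithConv (V →ₗ[k] k)} {t : V →ₗ[k] V}
    (h : ∀ f, (T f).ofConv = f.ofConv ∘ₗ t) :
    LinearMap.trace k _ T = LinearMap.trace k V t := by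
  rw [← LinearMap.trace_transpose' t, ← LinearMap.trace_conj' T (WithConv.linearEquiv k _)]
  congr 1
  ext f : 1
  exact h (toConv f)

/-- Let `φ`, `ρ` be commuting injective endomorphisms of a nine-dimensional simple coalgebra
such that `ρ` has order three and `ρ`, `ρ²` have trace zero. Then `(1 + ρ + ρ²) φ` has trace
`0` or `9`. -/
lemma Coalgebra.trace_average_comp_eq_zero_or_nine [IsAlgClosed k] [CharZero k]
    [FiniteDimensional k C] [IsSimpleRing (WithConv (C →ₗ[k] k))] (h9 : finrank k C = 9)
    {φ ρ : C →ₗc[k] C} (hφ : Function.Injective φ) (hρ : ∀ x, ρ (ρ (ρ x)) = x)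
    (hcomm : ∀ x, φ (ρ x) = ρ (φ x)) (h1 : LinearMap.trace k C ρ.toLinearMap = 0)
    (h2 : LinearMap.trace k C (ρ.toLinearMap ∘ₗ ρ.toLinearMap) = 0) {t : C →ₗ[k] C}
    (ht : ∀ x, t x = φ x + ρ (φ x) + ρ (ρ (φ x))) :
    LinearMap.trace k C t = 0 ∨ LinearMap.trace k C t = 9 := by
  have hρi : Function.Injective ρ := fun x y h ↦ by rw [← hρ x, h, hρ]
  have : FiniteDimensional k (WithConv (C →ₗ[k] k)) :=
    (WithConv.linearEquiv k (C →ₗ[k] k)).symm.finiteDimensional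
  let σ := dualAlgEquiv ρ hρi
  let τ := dualAlgEquiv φ hφ
  let T : WithConv (C →ₗ[k] k) →ₗ[k] WithConv (C →ₗ[k] k) := τ.toLinearMap ∘ₗ
    (LinearMap.id + σ.toLinearMap + σ.toLinearMap ∘ₗ σ.toLinearMap)
  rw [← LinearMap.trace_eq_trace_of_ofConv (T := T)]
  · refine AlgEquiv.trace_comp_average_eq_zero_or_nine (σ := σ) (τ := τ) ?_ ?_ ?_ ?_ ?_
      fun x ↦ rfl
    · rw [(WithConv.linearEquiv k (C →ₗ[k] k)).finrank_eq]
      exact (Subspace.dual_finrank_eq (K := k) (V := C)).trans h9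
    · intro f
      ext x
      exact congrArg f.ofConv (hcomm x)
    · intro f
      ext x
      exact congrArg f.ofConv (hρ x)
    · rw [LinearMap.trace_eq_trace_of_ofConv (t := ρ.toLinearMap), h1]
      intro f; rfl
    · rw [LinearMap.trace_eq_trace_of_ofConv (t := ρ.toLinearMap ∘ₗ ρ.toLinearMap), h2]
      intro f; rfl
  · intro f
    ext x
    rw [LinearMap.comp_apply f.ofConv, ht, map_add, map_add]
    rfl

end DualAlgebra

section Freeness

open Module Coalgebra WithConv

lemma Module.End.trace_mul_eq_of_conj {k V : Type*} [Field k] [AddCommGroup V] [Module k V]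
    {Q ρ ψ φ : End k V} (hψφ : ψ * φ = 1) (hQ : Q * Q = Q) (hψ : Q * (ψ * Q) = ψ * Q)
    (hφ : Q * (φ * Q) = φ * Q) (hρ : Q * (ρ * Q) = ρ * Q) :
    LinearMap.trace k V (Q * (φ * ρ * ψ)) = LinearMap.trace k V (Q * ρ) := by
  have h1 : ψ * Q * φ * Q = Q := by
    rw [mul_assoc, mul_assoc, hφ, ← mul_assoc, hψφ, one_mul]
  calc LinearMap.trace k V (Q * (φ * ρ * ψ))
      = LinearMap.trace k V (ψ * Q * φ * ρ) := by
        rw [← mul_assoc, LinearMap.trace_mul_comm]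
        simp only [mul_assoc]
    _ = LinearMap.trace k V (ρ * (ψ * Q) * φ) := by
        rw [LinearMap.trace_mul_comm]
        simp only [mul_assoc]
    _ = LinearMap.trace k V ((ρ * Q) * (ψ * Q) * φ) := by
        rw [mul_assoc ρ Q, hψ]
    _ = LinearMap.trace k V (Q * (ρ * Q * (ψ * Q * φ))) := by
        conv_lhs => rw [← hρ]
        simp only [mul_assoc]
    _ = LinearMap.trace k V (Q * ρ) := by
        rw [LinearMap.trace_mul_comm, mul_assoc _ _ Q, h1, mul_assoc, hQ,
          LinearMap.trace_mul_comm]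

variable {k H : Type} [Field k] [Ring H] [HopfAlgebra k H]

/-- The map `m ⊗ h ↦ m₁ ⊗ s(m₂) h`. -/
noncomputable def HopfAlgebra.twist (s : H →ₗ[k] H) : End k (H ⊗[k] H) :=
  (LinearMap.mul' k H ∘ₗ s.rTensor H).lTensor H ∘ₗ
    (TensorProduct.assoc k H H H).toLinearMap ∘ₗ (comul (R := k) (A := H)).rTensor H

open HopfAlgebra

lemma Coalgebra.Repr.twist_tmul (s : H →ₗ[k] H) {m : H} {ι : Type*} (r : Coalgebra.Repr k m ι)
    (h : H) : twist s (m ⊗ₜ[k] h) = ∑ i ∈ r.index, r.left i ⊗ₜ[k] (s (r.right i) * h) := by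
  simp [twist, ← r.eq, TensorProduct.sum_tmul]

lemma HopfAlgebra.twist_mul (s t : H →ₗ[k] H) :
    twist s * twist t = twist (k := k) (toConv s * toConv t).ofConv := by
  refine TensorProduct.ext' fun m h ↦ ?_
  have key := congrArg ((LinearMap.mulRight k h ∘ₗ LinearMap.mul' k H ∘ₗ
    TensorProduct.map s t).lTensor H)
    (sum_tmul_tmul_eq (ℛ k m) (fun i ↦ ℛ k _) (fun i ↦ ℛ k _))
  simp only [map_sum, LinearMap.lTensor_tmul, LinearMap.comp_apply, TensorProduct.map_tmul,
    LinearMap.mul'_apply, LinearMap.mulRight_apply] at key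
  rw [End.mul_apply, (ℛ k m).twist_tmul, (ℛ k m).twist_tmul, map_sum]
  simp only [(ℛ k _).twist_tmul, (ℛ k _).convMul_apply, Finset.sum_mul, TensorProduct.tmul_sum,
    ← mul_assoc]
  exact key

lemma HopfAlgebra.twist_one : twist (1 : WithConv (H →ₗ[k] H)).ofConv = 1 := by
  refine TensorProduct.ext' fun m h ↦ ?_
  rw [(ℛ k m).twist_tmul]
  simp only [LinearMap.convOne_apply, ← Algebra.smul_def, ← TensorProduct.smul_tmul,
    ← TensorProduct.sum_tmul]
  have := sliceRight_counit (k := k) m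
  rw [(ℛ k m).sliceRight] at this
  rw [this, End.one_apply]

/-- If `C` is a subcoalgebra stable under right multiplication by a group-like element `g`, with
inverse `g'`, then `Tr(· g | C) Tr(g' · | H) = Tr(· g | C) dim H`. -/
lemma IsSubcoalgebraOf.trace_mulRight_mul_trace_mulLeft [FiniteDimensional k H]
    {C : Submodule k H} (hC : IsSubcoalgebraOf (comul (R := k) (A := H)) C) {g g' : H}
    (hg : IsGroupLikeOf (comul (R := k) (A := H)) g) (hgg' : g * g' = 1)
    (hmaps : ∀ c ∈ C, c * g ∈ C) {P : End k H} (hP : LinearMap.IsProj C P) :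
    LinearMap.trace k H (P * LinearMap.mulRight k g) *
        LinearMap.trace k H (LinearMap.mulLeft k g') =
      LinearMap.trace k H (P * LinearMap.mulRight k g) * finrank k H := by
  set R := LinearMap.mulRight k g
  have hPP : P * P = P := LinearMap.ext fun x ↦ hP.map_id _ (hP.map_mem x)
  let Q : End k (H ⊗[k] H) := TensorProduct.map P LinearMap.id
  have hψφ : twist (k := k) (H := H) LinearMap.id * twist (antipode k) = 1 := by
    rw [twist_mul, LinearMap.id_mul_antipode, twist_one]
  have hφψ : twist (k := k) (H := H) (antipode k) * twist LinearMap.id = 1 := by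
    rw [twist_mul, LinearMap.antipode_mul_id, twist_one]
  have hQt : ∀ s : H →ₗ[k] H, Q * (twist s * Q) = twist s * Q := by
    intro s
    refine TensorProduct.ext' fun m h ↦ ?_
    obtain ⟨y, hy⟩ := hC (P m) (hP.map_mem m)
    change Q (twist s (P m ⊗ₜ h)) = twist s (P m ⊗ₜ h)
    simp only [twist, LinearMap.comp_apply, LinearMap.rTensor_tmul, ← hy]
    clear hy
    induction y with
    | zero => simp
    | tmul v w => simp [Q, hP.map_id _ v.2]
    | add x y hx hy => simp only [map_add, TensorProduct.add_tmul, hx, hy]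
  have hρ : Q * (TensorProduct.map R LinearMap.id * Q) = TensorProduct.map R LinearMap.id * Q := by
    refine TensorProduct.ext' fun m h ↦ ?_
    simp [Q, R, hP.map_id _ (hmaps _ (hP.map_mem m))]
  have hconj : twist (antipode k) * TensorProduct.map R LinearMap.id * twist LinearMap.id =
      TensorProduct.map R (LinearMap.mulLeft k g') := by
    have : TensorProduct.map R LinearMap.id * twist LinearMap.id =
        twist LinearMap.id * TensorProduct.map R (LinearMap.mulLeft k g') := by
      refine TensorProduct.ext' fun m h ↦ ?_
      change TensorProduct.map R LinearMap.id (twist LinearMap.id (m ⊗ₜ h)) =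
        twist LinearMap.id ((m * g) ⊗ₜ (g' * h))
      rw [(ℛ k m).twist_tmul]
      simp only [twist, LinearMap.comp_apply, LinearMap.rTensor_tmul, Bialgebra.comul_mul, hg.2,
        ← (ℛ k m).eq, Finset.sum_mul, TensorProduct.sum_tmul, map_sum]
      refine Finset.sum_congr rfl fun i _ ↦ ?_
      simp [R, mul_assoc, ← mul_assoc g g', hgg']
    rw [mul_assoc, this, ← mul_assoc, hφψ, one_mul]
  have h := Module.End.trace_mul_eq_of_conj (Q := Q) hψφ
    (by rw [← TensorProduct.map_mul, hPP]; rfl) (hQt _) (hQt _) hρ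
  rw [hconj] at h
  simp only [Q, ← TensorProduct.map_mul, LinearMap.trace_tensorProduct'] at h
  rw [show (LinearMap.id : End k H) = 1 from rfl, one_mul, one_mul, LinearMap.trace_one] at h
  exact h

lemma IsSubcoalgebraOf.trace_mul_mulRight_eq_zero [IsAlgClosed k] [CharZero k]
    [FiniteDimensional k H] {C : Submodule k H}
    (hC : IsSubcoalgebraOf (comul (R := k) (A := H)) C) {g : H}
    (hg : IsGroupLikeOf (comul (R := k) (A := H)) g) (hg1 : g ≠ 1) {p : ℕ} (hp : p.Prime)
    (hgp : g ^ p = 1) (hmaps : ∀ c ∈ C, c * g ∈ C) {P : End k H} (hP : LinearMap.IsProj C P) :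
    LinearMap.trace k H (P * LinearMap.mulRight k g) = 0 := by
  have hgg' : g * g ^ (p - 1) = 1 := by rw [← pow_succ', Nat.sub_add_cancel hp.one_le, hgp]
  by_contra h
  have htr := mul_left_cancel₀ h (hC.trace_mulRight_mul_trace_mulLeft hg hgg' hmaps hP)
  have hone := Module.End.eq_one_of_trace_eq_finrank hp
    (by
      rw [LinearMap.pow_mulLeft, ← pow_mul, mul_comm, pow_mul, hgp, one_pow,
        LinearMap.mulLeft_one]
      rfl) htr
  have : g ^ (p - 1) = 1 := by simpa using LinearMap.congr_fun hone 1
  exact hg1 (by rwa [this, mul_one] at hgg')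

lemma LinearMap.trace_restrict_eq_trace_mul {k V : Type*} [Field k] [AddCommGroup V] [Module k V]
    [FiniteDimensional k V] {C : Submodule k V} {P T : End k V} (hP : LinearMap.IsProj C P)
    (hT : ∀ c ∈ C, T c ∈ C) :
    LinearMap.trace k C (T.restrict hT) = LinearMap.trace k V (P * T) := by
  have h2 : hP.codRestrict ∘ₗ T ∘ₗ C.subtype = T.restrict hT := by
    ext c
    exact hP.map_id _ (hT c c.2)
  rw [← h2, LinearMap.trace_comp_comm']
  exact LinearMap.trace_mul_comm k T P

lemma Submodule.exists_isProj {k V : Type*} [Field k] [AddCommGroup V] [Module k V]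
    (C : Submodule k V) : ∃ P : End k V, LinearMap.IsProj C P := by
  obtain ⟨r, hr⟩ := C.subtype.exists_leftInverse_of_injective C.ker_subtype
  exact ⟨C.subtype ∘ₗ r, fun x ↦ (r x).2, fun x hx ↦
    congrArg Subtype.val (LinearMap.congr_fun hr ⟨x, hx⟩)⟩

end Freeness

section Antipode

open Module Coalgebra WithConv HopfAlgebra

variable {k H : Type} [Field k] [Ring H] [HopfAlgebra k H]

lemma Coalgebra.Repr.sum_antipode_tmul_one_mul_comul {b : H} {ι : Type*}
    (r : Coalgebra.Repr k b ι) :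
    ∑ i ∈ r.index, (antipode k (r.left i) ⊗ₜ[k] (1 : H)) * comul (R := k) (r.right i) =
      1 ⊗ₜ[k] b := by
  have key := congrArg ((LinearMap.mul' k H ∘ₗ (antipode k).rTensor H).rTensor H ∘ₗ
      (_root_.TensorProduct.assoc k H H H).symm.toLinearMap)
    (sum_tmul_tmul_eq r (fun i ↦ ℛ k _) (fun i ↦ ℛ k _))
  simp only [map_sum, LinearMap.comp_apply, LinearEquiv.coe_coe,
    _root_.TensorProduct.assoc_symm_tmul, LinearMap.rTensor_tmul, LinearMap.mul'_apply,
    ← TensorProduct.sum_tmul, sum_antipode_mul_eq_smul] at key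
  conv_rhs => rw [← sum_counit_smul r, TensorProduct.tmul_sum]
  simp only [TensorProduct.smul_tmul] at key
  rw [key]
  refine Finset.sum_congr rfl fun i _ ↦ ?_
  conv_lhs => rw [← (ℛ k (r.right i)).eq, Finset.mul_sum]
  simp

/-- The antipode is an anti-coalgebra map. -/
lemma HopfAlgebra.comul_antipode (a : H) :
    comul (R := k) (antipode k a) =
      TensorProduct.map (antipode k) (antipode k) (TensorProduct.comm k H H (comul a)) := by
  let G : H →ₗ[k] H ⊗[k] H := TensorProduct.map (antipode k) (antipode k) ∘ₗ
    (TensorProduct.comm k H H).toLinearMap ∘ₗ comul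
  have hG : toConv G * toConv (comul (R := k) (A := H)) = 1 := by
    ext1
    refine LinearMap.ext fun a ↦ ?_
    let M : H ⊗[k] (H ⊗[k] H) →ₗ[k] H ⊗[k] H :=
      LinearMap.mul' k (H ⊗[k] H) ∘ₗ TensorProduct.map
        (TensorProduct.map (antipode k) (antipode k) ∘ₗ
          (TensorProduct.comm k H H).toLinearMap) comul ∘ₗ
        (_root_.TensorProduct.assoc k H H H).symm.toLinearMap
    have hM : ∀ x y z : H, M (x ⊗ₜ (y ⊗ₜ z)) =
        (1 ⊗ₜ antipode k x) * ((antipode k y ⊗ₜ 1) * comul z) := fun x y z ↦ by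
      simp [M, ← mul_assoc]
    have key := congrArg M (sum_tmul_tmul_eq (ℛ k a) (fun i ↦ ℛ k _) (fun i ↦ ℛ k _))
    simp only [map_sum, hM] at key
    have hR : ∑ i ∈ (ℛ k a).index, ∑ j ∈ (ℛ k ((ℛ k a).right i)).index,
        (1 ⊗ₜ antipode k ((ℛ k a).left i)) *
          ((antipode k ((ℛ k ((ℛ k a).right i)).left j) ⊗ₜ 1) *
            comul (R := k) ((ℛ k ((ℛ k a).right i)).right j)) =
        counit (R := k) a • ((1 : H) ⊗ₜ[k] (1 : H)) := by
      simp only [← Finset.mul_sum, Coalgebra.Repr.sum_antipode_tmul_one_mul_comul,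
        Algebra.TensorProduct.tmul_mul_tmul, ← TensorProduct.tmul_sum, one_mul,
        sum_antipode_mul_eq_smul, TensorProduct.tmul_smul]
    rw [(ℛ k a).convMul_apply, LinearMap.convOne_apply, Algebra.algebraMap_eq_smul_one,
      Algebra.TensorProduct.one_def, ← hR, ← key]
    refine Finset.sum_congr rfl fun i _ ↦ ?_
    simp only [G, LinearMap.comp_apply]
    conv_lhs => rw [← (ℛ k ((ℛ k a).left i)).eq]
    simp [Finset.sum_mul, ← mul_assoc]
  have h := left_inv_eq_right_inv hG LinearMap.comul_right_inv
  exact (LinearMap.congr_fun (toConv_injective h) a).symm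

lemma HopfAlgebra.comul_antipode_antipode (a : H) :
    comul (R := k) (antipode k (antipode k a)) =
      TensorProduct.map (antipode k ∘ₗ antipode k) (antipode k ∘ₗ antipode k) (comul a) := by
  rw [comul_antipode, comul_antipode]
  generalize comul (R := k) a = t
  induction t with
  | zero => simp
  | tmul x y => simp
  | add x y hx hy => simp only [map_add, hx, hy]

end Antipode

section Integral

open Module Coalgebra HopfAlgebra

variable {k H : Type} [Field k] [Ring H] [HopfAlgebra k H]

lemma Coalgebra.Repr.sum_smul_antipode_mul_antipode_antipode {h : H} {ι : Type*}
    (r : Coalgebra.Repr k h ι) (f : H →ₗ[k] k) (x y : H) :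
    ∑ i ∈ r.index, ∑ j ∈ (ℛ k (r.left i)).index, f ((ℛ k (r.left i)).left j * x) •
      (antipode k (r.right i) * antipode k (antipode k ((ℛ k (r.left i)).right j * y))) =
    f (h * x) • antipode k (antipode k y) := by
  let Φ : H ⊗[k] (H ⊗[k] H) →ₗ[k] H :=
    (_root_.TensorProduct.lid k H).toLinearMap ∘ₗ
      _root_.TensorProduct.map (f ∘ₗ LinearMap.mulRight k x)
        (antipode k ∘ₗ LinearMap.mul' k H ∘ₗ
          (antipode k ∘ₗ LinearMap.mulRight k y).rTensor H)
  have hΦ : ∀ u v w : H, Φ (u ⊗ₜ (v ⊗ₜ w)) =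
      f (u * x) • antipode k (antipode k (v * y) * w) := fun u v w ↦ by simp [Φ]
  have key := congrArg Φ (sum_tmul_tmul_eq r (fun i ↦ ℛ k _) (fun i ↦ ℛ k _))
  simp only [map_sum, hΦ] at key
  simp only [← antipode_mul_antidistrib]
  rw [key]
  simp only [antipode_mul_antidistrib (R := k) _ y, mul_assoc, ← Finset.smul_sum, ← map_sum,
    ← Finset.mul_sum, sum_antipode_mul_eq_smul, mul_smul_comm, mul_one, map_smul]
  simp only [smul_smul, ← Finset.sum_smul]
  congr 1
  have h1 := congrArg (f ∘ₗ LinearMap.mulRight k x) (sliceRight_counit (k := k) h)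
  rw [r.sliceRight] at h1
  simpa [mul_comm] using h1

lemma Coalgebra.Repr.antipode_antipode_sliceLeft_mulLeft {h : H} {ι : Type*}
    (r : Coalgebra.Repr k h ι) (f : Dual k H) :
    (antipode k ∘ₗ antipode k) ∘ₗ Coalgebra.sliceLeft (f ∘ₗ LinearMap.mulLeft k h) =
      ∑ i ∈ r.index, LinearMap.mulLeft k (antipode k (r.right i)) ∘ₗ
        ((antipode k ∘ₗ antipode k) ∘ₗ Coalgebra.sliceLeft f) ∘ₗ
          LinearMap.mulLeft k (r.left i) := by
  ext x
  have h1 : ∀ i, Coalgebra.sliceLeft f (r.left i * x) = ∑ j ∈ (ℛ k (r.left i)).index,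
      ∑ m ∈ (ℛ k x).index, f ((ℛ k (r.left i)).left j * (ℛ k x).left m) •
        ((ℛ k (r.left i)).right j * (ℛ k x).right m) := fun i ↦ by
    simp [Coalgebra.sliceLeft, ← (ℛ k (r.left i)).eq, ← (ℛ k x).eq, Finset.sum_mul_sum]
  simp only [LinearMap.comp_apply, (ℛ k x).sliceLeft, LinearMap.sum_apply,
    LinearMap.mulLeft_apply, h1, map_sum, map_smul]
  simp only [← r.sum_smul_antipode_mul_antipode_antipode]
  rw [Finset.sum_comm]
  exact Finset.sum_congr rfl fun i _ ↦ Finset.sum_comm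

/-- A left integral `Λ` with `ε(Λ) = Tr(S² · a)`. -/
lemma HopfAlgebra.exists_integral [FiniteDimensional k H] (a : H) :
    ∃ Λ : H, (∀ h, h * Λ = counit (R := k) h • Λ) ∧
      counit (R := k) Λ =
        LinearMap.trace k H (LinearMap.mulRight k a ∘ₗ antipode k ∘ₗ antipode k) := by
  let F : Dual k (Dual k H) :=
    { toFun := fun f ↦ LinearMap.trace k H
        (LinearMap.mulRight k a ∘ₗ (antipode k ∘ₗ antipode k) ∘ₗ Coalgebra.sliceLeft f)
      map_add' := fun f g ↦ by
        simp only [Coalgebra.sliceLeft, LinearMap.rTensor_add, LinearMap.add_comp,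
          LinearMap.comp_add, map_add]
      map_smul' := fun c f ↦ by
        simp only [Coalgebra.sliceLeft, LinearMap.rTensor_smul, LinearMap.smul_comp,
          LinearMap.comp_smul, map_smul, RingHom.id_apply] }
  let Λ : H := (evalEquiv k H).symm F
  have hΛ : ∀ f : Dual k H, f Λ = F f := fun f ↦ by
    rw [← apply_evalEquiv_symm_apply]
  refine ⟨Λ, fun h ↦ ?_, ?_⟩
  · rw [← sub_eq_zero, ← forall_dual_apply_eq_zero_iff k]
    intro f
    have h1 : f (h * Λ) = F (f ∘ₗ LinearMap.mulLeft k h) := hΛ (f ∘ₗ LinearMap.mulLeft k h)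
    rw [map_sub, h1, map_smul, hΛ, sub_eq_zero]
    change LinearMap.trace k H _ = counit (R := k) h • LinearMap.trace k H _
    rw [(ℛ k h).antipode_antipode_sliceLeft_mulLeft]
    generalize (antipode k ∘ₗ antipode k) ∘ₗ Coalgebra.sliceLeft f = Q
    have h2 : ∀ b c : H, LinearMap.trace k H (LinearMap.mulRight k a ∘ₗ
        LinearMap.mulLeft k b ∘ₗ Q ∘ₗ LinearMap.mulLeft k c) =
        LinearMap.trace k H (LinearMap.mulLeft k (c * b) ∘ₗ LinearMap.mulRight k a ∘ₗ Q) := by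
      intro b c
      rw [← LinearMap.comp_assoc, ← LinearMap.comp_assoc, LinearMap.trace_comp_comm']
      congr 1
      ext x
      simp [mul_assoc]
    have h3 : ∑ i ∈ (ℛ k h).index, LinearMap.mulLeft k
        ((ℛ k h).left i * antipode k ((ℛ k h).right i)) =
        counit (R := k) h • (LinearMap.id : H →ₗ[k] H) := by
      ext x
      simp only [LinearMap.sum_apply, LinearMap.mulLeft_apply, ← Finset.sum_mul,
        sum_mul_antipode_eq_smul, LinearMap.smul_apply, LinearMap.id_apply, smul_mul_assoc,
        one_mul]
    simp only [← Module.End.mul_eq_comp, Finset.mul_sum, map_sum] at h2 h3 ⊢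
    simp only [h2]
    rw [← map_sum, ← Finset.sum_mul, h3, smul_mul_assoc, map_smul]
    rfl
  · rw [hΛ]
    change LinearMap.trace k H _ = _
    congr 1
    ext x
    simp [sliceLeft_counit]

/-- The Casimir identity for a left integral. -/
lemma Coalgebra.Repr.sum_mul_tmul_antipode {Λ : H}
    (hΛ : ∀ h, h * Λ = counit (R := k) h • Λ) {ι : Type*} (r : Coalgebra.Repr k Λ ι) (h : H) :
    ∑ i ∈ r.index, (h * r.left i) ⊗ₜ[k] antipode k (r.right i) =
      ∑ i ∈ r.index, r.left i ⊗ₜ[k] (antipode k (r.right i) * h) := by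
  let Ψ : H → H ⊗[k] H →ₗ[k] H ⊗[k] H := fun w ↦
    (LinearMap.mulRight k w ∘ₗ antipode k).lTensor H
  let Φ : H ⊗[k] (H ⊗[k] H) →ₗ[k] H ⊗[k] H :=
    (LinearMap.mul' k H ∘ₗ (antipode k).rTensor H).lTensor H ∘ₗ
      ∑ i ∈ r.index, _root_.TensorProduct.map (LinearMap.mulRight k (r.left i))
        ((LinearMap.mulRight k (r.right i)).rTensor H)
  have hΦ : ∀ u v w : H, Φ (u ⊗ₜ (v ⊗ₜ w)) =
      ∑ i ∈ r.index, (u * r.left i) ⊗ₜ (antipode k (v * r.right i) * w) := fun u v w ↦ by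
    simp [Φ]
  have key := congrArg Φ (sum_tmul_tmul_eq (ℛ k h) (fun i ↦ ℛ k _) (fun i ↦ ℛ k _))
  simp only [map_sum, hΦ] at key
  have hL : ∀ u w : H, ∑ j ∈ (ℛ k u).index, ∑ i ∈ r.index,
      ((ℛ k u).left j * r.left i) ⊗ₜ[k] (antipode k ((ℛ k u).right j * r.right i) * w) =
      counit (R := k) u • Ψ w (comul Λ) := by
    intro u w
    rw [← map_smul, ← map_smul, ← hΛ, Bialgebra.comul_mul, ← r.eq, ← (ℛ k u).eq,
      Finset.sum_mul_sum]
    simp [Ψ]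
  have hLHS : ∑ i ∈ (ℛ k h).index, counit (R := k) ((ℛ k h).left i) •
      Ψ ((ℛ k h).right i) (comul Λ) = Ψ h (comul Λ) := by
    conv_rhs => rw [← sum_counit_smul (ℛ k h)]
    simp only [← r.eq, map_sum, Ψ, LinearMap.lTensor_tmul, LinearMap.comp_apply,
      LinearMap.mulRight_apply, Finset.mul_sum, _root_.TensorProduct.tmul_sum, mul_smul_comm,
      _root_.TensorProduct.tmul_smul, Finset.smul_sum]
    exact Finset.sum_comm
  simp only [hL] at key
  rw [hLHS] at key
  simp only [← r.eq, map_sum, Ψ, LinearMap.lTensor_tmul, LinearMap.comp_apply,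
    LinearMap.mulRight_apply] at key
  rw [key]
  simp only [antipode_mul_antidistrib (R := k) _ (r.right _), mul_assoc]
  rw [Finset.sum_congr rfl fun i _ ↦ Finset.sum_comm]
  simp only [← _root_.TensorProduct.tmul_sum, ← Finset.mul_sum, sum_antipode_mul_eq_smul]
  rw [Finset.sum_comm]
  refine Finset.sum_congr rfl fun i _ ↦ ?_
  simp only [mul_smul_comm, mul_one, ← _root_.TensorProduct.smul_tmul,
    ← _root_.TensorProduct.sum_tmul, ← smul_mul_assoc, ← Finset.sum_mul]
  have h1 := sliceRight_counit (k := k) h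
  rw [(ℛ k h).sliceRight] at h1
  rw [h1]

/-- **Maschke's theorem** for Hopf algebras. -/
lemma HopfAlgebra.isSemisimpleRing_of_integral {Λ : H}
    (hΛ : ∀ h, h * Λ = counit (R := k) h • Λ) (h1 : counit (R := k) Λ = 1) :
    IsSemisimpleRing H := by
  refine (isSemisimpleModule_iff H H).mpr ⟨fun N ↦ ?_⟩
  obtain ⟨P, hP⟩ := (N.restrictScalars k).exists_isProj
  let r := ℛ k Λ
  let B : H → H ⊗[k] H →ₗ[k] H := fun x ↦
    LinearMap.mul' k H ∘ₗ (P ∘ₗ LinearMap.mulRight k x).lTensor H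
  let T : H →ₗ[H] N :=
    { toFun := fun x ↦ ⟨∑ i ∈ r.index, r.left i * P (antipode k (r.right i) * x),
        N.sum_mem fun i _ ↦ N.smul_mem _ (hP.map_mem _)⟩
      map_add' := fun x y ↦ by
        ext
        simp [mul_add, Finset.sum_add_distrib]
      map_smul' := fun h x ↦ by
        ext
        simpa [B, Finset.mul_sum, mul_assoc] using
          (congrArg (B x) (r.sum_mul_tmul_antipode hΛ h)).symm }
  refine ⟨_, LinearMap.isCompl_of_proj (f := T) fun x ↦ ?_⟩
  ext
  change ∑ i ∈ r.index, r.left i * P (antipode k (r.right i) * x) = x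
  have hx : ∀ y : H, P (y * x) = y * x := fun y ↦ hP.map_id _ (N.smul_mem y x.2)
  simp only [hx, ← mul_assoc]
  rw [← Finset.sum_mul, sum_mul_antipode_eq_smul, h1, one_smul, one_mul]

/-- If `Tr(S² · a) ≠ 0` for some `a`, then `H` is semisimple. -/
lemma HopfAlgebra.isSemisimpleRing_of_trace_ne_zero [FiniteDimensional k H] {a : H}
    (ha : LinearMap.trace k H (LinearMap.mulRight k a ∘ₗ antipode k ∘ₗ antipode k) ≠ 0) :
    IsSemisimpleRing H := by
  obtain ⟨Λ, hΛ, hε⟩ := HopfAlgebra.exists_integral (k := k) a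
  refine HopfAlgebra.isSemisimpleRing_of_integral (k := k) (Λ := (counit (R := k) Λ)⁻¹ • Λ)
    (fun h ↦ ?_) ?_
  · rw [mul_smul_comm, hΛ, smul_comm]
  · rw [map_smul, smul_eq_mul, inv_mul_cancel₀ (hε ▸ ha)]

end Integral

section Translates

open Module Coalgebra HopfAlgebra

variable {k H : Type} [Field k] [Ring H] [HopfAlgebra k H]

lemma isGroupLikeOf_iff {a : H} :
    IsGroupLikeOf (comul (R := k) (A := H)) a ↔ IsGroupLikeElem k a := by
  refine ⟨fun h ↦ ⟨?_, h.2⟩, fun h ↦ ⟨h.ne_zero, h.2⟩⟩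
  have h1 := sliceLeft_counit (k := k) a
  rw [sliceLeft, LinearMap.comp_apply, LinearMap.comp_apply, h.2] at h1
  have h2 : counit (R := k) a • a = (1 : k) • a := by simpa using h1
  exact smul_left_injective k h.1 h2

lemma GroupLike.isGroupLikeOf (g : GroupLike k H) :
    IsGroupLikeOf (comul (R := k) (A := H)) (g : H) :=
  isGroupLikeOf_iff.mpr g.2

lemma GroupLike.exists_orderOf_eq [FiniteDimensional k H] {p : ℕ} (hp : p.Prime)
    (hdvd : p ∣ Nat.card {a : H // IsGroupLikeOf (comul (R := k) (A := H)) a}) :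
    ∃ g : GroupLike k H, orderOf g = p := by
  have := Fact.mk hp
  have : Finite (GroupLike k H) :=
    (linearIndep_groupLikeVal (R := k) (A := H)).finite
  refine exists_prime_orderOf_dvd_card' p (hdvd.trans (dvd_of_eq ?_))
  exact (Nat.card_congr ((Equiv.subtypeEquivRight fun _ ↦ isGroupLikeOf_iff).trans
    GroupLike.valEquiv.symm))

lemma GroupLike.span_singleton_injective :
    Function.Injective fun g : GroupLike k H ↦ Submodule.span k {(g : H)} := by
  intro g h hgh
  obtain ⟨c, hc⟩ := Submodule.mem_span_singleton.mp
    ((show Submodule.span k {(g : H)} = Submodule.span k {(h : H)} from hgh) ▸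
      Submodule.mem_span_singleton_self (g : H))
  have h1 := congrArg (counit (R := k)) hc
  rw [map_smul, g.2.1, h.2.1, smul_eq_mul, mul_one] at h1
  exact GroupLike.val_injective (by rw [← hc, h1, one_smul])

lemma GroupLike.comul_mulRight (g : GroupLike k H) (x : H) :
    comul (R := k) (LinearMap.mulRight k (g : H) x) =
      TensorProduct.map (LinearMap.mulRight k (g : H)) (LinearMap.mulRight k (g : H))
        (comul x) := by
  rw [LinearMap.mulRight_apply, Bialgebra.comul_mul, g.2.2]
  generalize comul (R := k) x = t
  induction t with
  | zero => simp
  | tmul x y => simp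
  | add x y hx hy => simp only [map_add, add_mul, hx, hy]

/-- Right translation of subspaces by a group-like element. -/
noncomputable def GroupLike.translate (g : GroupLike k H) (C : Submodule k H) : Submodule k H :=
  C.map (LinearMap.mulRight k (g : H))

lemma GroupLike.translate_translate (g h : GroupLike k H) (C : Submodule k H) :
    h.translate (g.translate C) = (g * h).translate C := by
  rw [translate, translate, translate, ← Submodule.map_comp]
  congr 1
  ext x
  simp [mul_assoc]

lemma GroupLike.translate_one (C : Submodule k H) : (1 : GroupLike k H).translate C = C := by
  simp [translate]

lemma GroupLike.iterate_translate (g : GroupLike k H) (n : ℕ) (C : Submodule k H) :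
    g.translate^[n] C = (g ^ n).translate C := by
  induction n with
  | zero => rw [pow_zero, translate_one, Function.iterate_zero, id]
  | succ n ih => rw [Function.iterate_succ_apply', ih, translate_translate, pow_succ]

lemma GroupLike.finrank_translate [FiniteDimensional k H] (g : GroupLike k H)
    (C : Submodule k H) : finrank k (g.translate C) = finrank k C := by
  refine le_antisymm (Submodule.finrank_map_le _ _) ?_
  conv_lhs => rw [← translate_one C, ← mul_inv_cancel g, ← translate_translate]
  exact Submodule.finrank_map_le _ _

lemma IsSubcoalgebraOf.translate {C : Submodule k H}
    (hC : IsSubcoalgebraOf (comul (R := k) (A := H)) C) (g : GroupLike k H) :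
    IsSubcoalgebraOf (comul (R := k) (A := H)) (g.translate C) :=
  hC.map g.comul_mulRight

lemma IsSimpleSubcoalgebraOf.translate {C : Submodule k H}
    (hC : IsSimpleSubcoalgebraOf (comul (R := k) (A := H)) C) (g : GroupLike k H) :
    IsSimpleSubcoalgebraOf (comul (R := k) (A := H)) (g.translate C) := by
  have hinv : ∀ D : Submodule k H, g.translate (g⁻¹.translate D) = D := fun D ↦ by
    rw [GroupLike.translate_translate, inv_mul_cancel, GroupLike.translate_one]
  have hinv' : g⁻¹.translate (g.translate C) = C := by
    rw [GroupLike.translate_translate, mul_inv_cancel, GroupLike.translate_one]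
  refine ⟨hC.1.translate g, fun h ↦ hC.2.1 ?_, fun D hD hle ↦ ?_⟩
  · rw [← hinv', h, GroupLike.translate, Submodule.map_bot]
  · refine (hC.2.2 _ (hD.translate g⁻¹) (hinv'.le.trans' (Submodule.map_mono hle))).imp
      (fun h ↦ ?_) (fun h ↦ ?_)
    · rw [← hinv D, h, GroupLike.translate, Submodule.map_bot]
    · rw [← hinv D, h]

/-- The span of the powers of a group-like element. -/
noncomputable def GroupLike.spanPowers (g : GroupLike k H) : Submodule k H :=
  ((Finset.range (orderOf g)).image fun i ↦ Submodule.span k {((g ^ i : GroupLike k H) : H)}).sup id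

lemma GroupLike.isSubcoalgebraOf_spanPowers (g : GroupLike k H) :
    IsSubcoalgebraOf (comul (R := k) (A := H)) g.spanPowers :=
  Finset.sup_induction .bot (fun _ h _ h' ↦ h.sup h') fun D hD ↦ by
    obtain ⟨i, -, rfl⟩ := Finset.mem_image.mp hD
    exact .span_singleton (GroupLike.isGroupLikeOf _)

lemma IsSimpleSubcoalgebraOf.inf_spanPowers {C : Submodule k H}
    (hC : IsSimpleSubcoalgebraOf (comul (R := k) (A := H)) C) (h1 : finrank k C ≠ 1)
    (g : GroupLike k H) : C ⊓ g.spanPowers = ⊥ := by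
  by_contra h
  have hle := hC.le_of_inf_ne_bot g.isSubcoalgebraOf_spanPowers h
  obtain ⟨i, -, rfl⟩ := Finset.mem_image.mp (hC.exists_mem_le_of_le_sup (fun D hD ↦ by
    obtain ⟨i, -, rfl⟩ := Finset.mem_image.mp hD
    exact .span_singleton (GroupLike.isGroupLikeOf _)) hle)
  exact h1 (finrank_span_singleton (GroupLike.isGroupLikeOf (g ^ i)).1)

lemma GroupLike.spanPowers_le {g : GroupLike k H} {D : Submodule k H}
    (h : ∀ n : ℕ, ((g ^ n : GroupLike k H) : H) ∈ D) : g.spanPowers ≤ D :=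
  Finset.sup_le fun E hE ↦ by
    obtain ⟨i, -, rfl⟩ := Finset.mem_image.mp hE
    exact (Submodule.span_singleton_le_iff_mem _ _).mpr (h i)

lemma GroupLike.pow_mem_spanPowers {g : GroupLike k H} (hg : 0 < orderOf g) (n : ℕ) :
    ((g ^ n : GroupLike k H) : H) ∈ g.spanPowers := by
  rw [← pow_mod_orderOf]
  exact Finset.le_sup (f := id) (Finset.mem_image_of_mem
    (fun i ↦ Submodule.span k {((g ^ i : GroupLike k H) : H)})
    (Finset.mem_range.mpr (Nat.mod_lt n hg))) (Submodule.mem_span_singleton_self _)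

lemma GroupLike.mul_mem_spanPowers {g : GroupLike k H} (hg : 0 < orderOf g) {x : H}
    (hx : x ∈ g.spanPowers) : x * g ∈ g.spanPowers := by
  suffices g.spanPowers ≤ g.spanPowers.comap (LinearMap.mulRight k (g : H)) from this hx
  refine GroupLike.spanPowers_le fun n ↦ ?_
  have := GroupLike.pow_mem_spanPowers hg (n + 1)
  rwa [pow_succ] at this

lemma GroupLike.sum_finrank_image (g : GroupLike k H) :
    ∑ D ∈ (Finset.range (orderOf g)).image
      fun i ↦ Submodule.span k {((g ^ i : GroupLike k H) : H)}, finrank k D = orderOf g := by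
  rw [Finset.sum_image fun i hi j hj h ↦ pow_injOn_Iio_orderOf
    (Finset.mem_range.mp hi) (Finset.mem_range.mp hj) (GroupLike.span_singleton_injective h)]
  rw [Finset.sum_congr rfl fun i _ ↦ finrank_span_singleton (GroupLike.isGroupLikeOf (g ^ i)).1]
  simp

variable [FiniteDimensional k H]

lemma GroupLike.orderOf_le_finrank_spanPowers (g : GroupLike k H) :
    orderOf g ≤ finrank k g.spanPowers := by
  rw [← g.sum_finrank_image]
  refine IsSimpleSubcoalgebraOf.sum_finrank_le _ fun D hD ↦ ?_
  obtain ⟨i, -, rfl⟩ := Finset.mem_image.mp hD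
  exact .span_singleton (GroupLike.isGroupLikeOf _)

lemma GroupLike.sum_finrank_add_orderOf_le (g : GroupLike k H) {s : Finset (Submodule k H)}
    (hs : ∀ D ∈ s, IsSimpleSubcoalgebraOf (comul (R := k) (A := H)) D ∧ finrank k D ≠ 1) :
    ∑ D ∈ s, finrank k D + orderOf g ≤ finrank k H := by
  classical
  have hdisj : Disjoint s ((Finset.range (orderOf g)).image
      fun i ↦ Submodule.span k {((g ^ i : GroupLike k H) : H)}) := by
    refine Finset.disjoint_left.mpr fun D hD hD' ↦ (hs D hD).2 ?_
    obtain ⟨i, -, rfl⟩ := Finset.mem_image.mp hD'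
    exact finrank_span_singleton (GroupLike.isGroupLikeOf _).1
  conv_lhs => rw [← g.sum_finrank_image]
  refine le_trans (le_of_eq ?_) ((IsSimpleSubcoalgebraOf.sum_finrank_le _ fun D hD ↦ ?_).trans
    (Submodule.finrank_le (Finset.sup (s ∪ (Finset.range (orderOf g)).image
      fun i ↦ Submodule.span k {((g ^ i : GroupLike k H) : H)}) id)))
  · rw [Finset.sum_union hdisj]
  · rcases Finset.mem_union.mp hD with hD | hD
    · exact (hs D hD).1
    · obtain ⟨i, -, rfl⟩ := Finset.mem_image.mp hD
      exact .span_singleton (GroupLike.isGroupLikeOf _)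

/-- In a Hopf algebra of dimension at most `4p`, a simple subcoalgebra of dimension at least four
is stable under translation by a group-like element of prime order `p`. -/
lemma IsSimpleSubcoalgebraOf.translate_eq_self {C : Submodule k H}
    (hC : IsSimpleSubcoalgebraOf (comul (R := k) (A := H)) C) {g : GroupLike k H}
    (hp : (orderOf g).Prime) (hdim : finrank k H ≤ 4 * orderOf g) (h4 : 4 ≤ finrank k C) :
    g.translate C = C := by
  by_contra h
  have := Fact.mk hp
  have hper : Function.minimalPeriod g.translate C = orderOf g := by
    refine Function.minimalPeriod_eq_prime ?_ h
    change g.translate^[orderOf g] C = C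
    rw [g.iterate_translate, pow_orderOf_eq_one, GroupLike.translate_one]
  have hfin : ∀ i, finrank k (g.translate^[i] C) = finrank k C := fun i ↦ by
    rw [g.iterate_translate, GroupLike.finrank_translate]
  have hle := g.sum_finrank_add_orderOf_le
    (s := (Finset.range (orderOf g)).image fun i ↦ g.translate^[i] C) fun D hD ↦ by
      obtain ⟨i, -, rfl⟩ := Finset.mem_image.mp hD
      refine ⟨?_, by rw [hfin]; omega⟩
      rw [g.iterate_translate]
      exact hC.translate _
  rw [Finset.sum_image fun i hi j hj hij ↦ Function.iterate_injOn_Iio_minimalPeriod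
    (by rw [hper]; simpa using hi) (by rw [hper]; simpa using hj) hij] at hle
  rw [Finset.sum_congr rfl fun i _ ↦ hfin i, Finset.sum_const, Finset.card_range,
    smul_eq_mul] at hle
  nlinarith [hp.pos]

end Translates

section SimpleSubcoalgebras

open Module Coalgebra HopfAlgebra

variable {k H : Type} [Field k] [Ring H] [HopfAlgebra k H]

/-- The restriction of a coalgebra endomorphism to a stable subcoalgebra. -/
noncomputable def IsSubcoalgebraOf.restrictHom {C : Submodule k H}
    (hC : IsSubcoalgebraOf (comul (R := k) (A := H)) C) {F : H →ₗ[k] H}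
    (hF : ∀ c ∈ C, F c ∈ C) (hε : ∀ x, counit (R := k) (F x) = counit (R := k) x)
    (hΔ : ∀ x, comul (R := k) (F x) = TensorProduct.map F F (comul x)) :
    letI := hC.coalgebra
    C →ₗc[k] C :=
  letI := hC.coalgebra
  { F.restrict hF with
    counit_comp := LinearMap.ext fun x ↦ hε x
    map_comp_comul := by
      refine LinearMap.ext fun x ↦ TensorProduct.map_injective_of_flat_flat _ _
        C.subtype_injective C.subtype_injective ?_
      change _ = TensorProduct.map C.subtype C.subtype (hC.coalgebra.comul (F.restrict hF x))
      rw [hC.map_subtype_comul, LinearMap.coe_restrict_apply, hΔ, ← hC.map_subtype_comul]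
      change TensorProduct.map _ _ (TensorProduct.map _ _ _) = _
      generalize hC.coalgebra.comul x = t
      induction t with
      | zero => simp
      | tmul x y => rfl
      | add x y hx hy => simp only [map_add, hx, hy] }

lemma GroupLike.mulRight_pow_orderOf (g : GroupLike k H) :
    LinearMap.mulRight k (g : H) ^ orderOf g = 1 := by
  rw [LinearMap.pow_mulRight, ← GroupLike.val_pow, pow_orderOf_eq_one, GroupLike.val_one,
    LinearMap.mulRight_one]
  rfl

variable [IsAlgClosed k] [CharZero k] [FiniteDimensional k H]

lemma IsSubcoalgebraOf.trace_restrict_mulRight_eq_zero {C : Submodule k H}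
    (hC : IsSubcoalgebraOf (comul (R := k) (A := H)) C) {g : GroupLike k H}
    (hp : (orderOf g).Prime) (hmaps : ∀ c ∈ C, LinearMap.mulRight k (g : H) c ∈ C) :
    LinearMap.trace k C ((LinearMap.mulRight k (g : H)).restrict hmaps) = 0 := by
  obtain ⟨P, hP⟩ := C.exists_isProj
  rw [LinearMap.trace_restrict_eq_trace_mul hP]
  refine hC.trace_mul_mulRight_eq_zero g.isGroupLikeOf (fun h ↦ ?_) hp ?_ hmaps hP
  · have : g = 1 := GroupLike.val_injective h
    exact hp.one_lt.ne' (this ▸ orderOf_one)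
  · rw [← GroupLike.val_pow, pow_orderOf_eq_one, GroupLike.val_one]

/-- If `p` divides the number of group-like elements of a `4p`-dimensional Hopf algebra, a simple
subcoalgebra of dimension other than one has dimension nine, and `p = 3`. -/
lemma IsSimpleSubcoalgebraOf.finrank_eq_nine {C : Submodule k H}
    (hC : IsSimpleSubcoalgebraOf (comul (R := k) (A := H)) C) (h1 : finrank k C ≠ 1)
    {g : GroupLike k H} (hp : (orderOf g).Prime) (hodd : Odd (orderOf g))
    (hdim : finrank k H = 4 * orderOf g) :
    orderOf g = 3 ∧ finrank k C = 9 ∧ ∀ c ∈ C, LinearMap.mulRight k (g : H) c ∈ C := by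
  obtain ⟨d, hd⟩ := hC.exists_finrank_eq_mul_self
  have h0 : finrank k C ≠ 0 := fun h ↦ hC.2.1 (Submodule.finrank_eq_zero.mp h)
  have hd2 : 2 ≤ d := by
    rcases d with _ | _ | d <;> simp_all
  have htr := hC.translate_eq_self hp hdim.le (by nlinarith)
  have hmaps : ∀ c ∈ C, LinearMap.mulRight k (g : H) c ∈ C := fun c hc ↦
    htr.le (Submodule.mem_map_of_mem hc)
  have hpow : (LinearMap.mulRight k (g : H)).restrict hmaps ^ orderOf g = 1 := by
    rw [Module.End.pow_restrict]
    ext c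
    simp [g.mulRight_pow_orderOf]
  have hdvd := Module.End.dvd_finrank_of_trace_eq_zero hp hpow
    (hC.1.trace_restrict_mulRight_eq_zero hp hmaps)
  have hle := g.sum_finrank_add_orderOf_le (s := {C}) fun D hD ↦ by
    rw [Finset.mem_singleton.mp hD]
    exact ⟨hC, h1⟩
  rw [Finset.sum_singleton, hdim, hd] at hle
  rw [hd] at hdvd
  obtain ⟨m, rfl⟩ := (hp.dvd_mul.mp hdvd).elim id id
  have hm : 0 < m := Nat.pos_of_ne_zero fun h ↦ by simp [h] at hd2
  have hp2 := hp.two_le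
  have hp3 : orderOf g = 3 := by
    have hn : orderOf g ≤ orderOf g * m := Nat.le_mul_of_pos_right _ hm
    have : orderOf g ≤ 3 := by nlinarith
    interval_cases h : orderOf g
    · exact absurd hodd (by decide)
    · rfl
  refine ⟨hp3, ?_, hmaps⟩
  rw [hp3] at hle hd
  have : m = 1 := by nlinarith
  rw [hd, this]

/-- In a twelve-dimensional Hopf algebra with a group-like element of order three, a
nine-dimensional simple subcoalgebra forces semisimplicity. -/
lemma IsSimpleSubcoalgebraOf.isSemisimpleRing {C : Submodule k H}
    (hC : IsSimpleSubcoalgebraOf (comul (R := k) (A := H)) C) (h9 : finrank k C = 9)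
    {g : GroupLike k H} (hg : orderOf g = 3) (hdim : finrank k H = 12)
    (hmaps : ∀ c ∈ C, LinearMap.mulRight k (g : H) c ∈ C) : IsSemisimpleRing H := by
  set S2 : H →ₗ[k] H := antipode k ∘ₗ antipode k with hS2
  set R := LinearMap.mulRight k (g : H) with hR
  set a : H := 1 + g + g * g with ha
  let T : End k H := LinearMap.mulRight k a ∘ₗ S2
  refine HopfAlgebra.isSemisimpleRing_of_trace_ne_zero (k := k) (a := a)
    (show LinearMap.trace k H T ≠ 0 from ?_)
  have hinf := hC.inf_spanPowers (by omega) g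
  have hsum := Submodule.finrank_sup_add_finrank_inf_eq C g.spanPowers
  have hK := g.orderOf_le_finrank_spanPowers
  rw [hinf, finrank_bot] at hsum
  have hsup : C ⊔ g.spanPowers = ⊤ :=
    Submodule.eq_top_of_finrank_eq
      (le_antisymm (Submodule.finrank_le _) (by omega))
  have hcompl : IsCompl C g.spanPowers := ⟨disjoint_iff.mpr hinf, codisjoint_iff.mpr hsup⟩
  have hg3 : (g : H) * g * g = 1 := by
    have := congrArg GroupLike.val (pow_orderOf_eq_one g)
    rwa [hg, GroupLike.val_pow, GroupLike.val_one, pow_succ, pow_two] at this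
  have hpos : 0 < orderOf g := by omega
  have hKmul : ∀ x ∈ g.spanPowers, x * a ∈ g.spanPowers := fun x hx ↦ by
    have h1 := GroupLike.mul_mem_spanPowers hpos hx
    have h2 := GroupLike.mul_mem_spanPowers hpos h1
    rw [ha, mul_add, mul_add, mul_one, ← mul_assoc]
    exact add_mem (add_mem hx h1) h2
  have haK : a ∈ g.spanPowers := by
    have := hKmul 1 (by simpa using GroupLike.pow_mem_spanPowers hpos 0)
    rwa [one_mul] at this
  have hS2g : S2 (g : H) = g := g.2.antipode_antipode
  have hTK : ∀ x ∈ g.spanPowers, T x = counit (R := k) x • a := by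
    suffices g.spanPowers ≤
        LinearMap.eqLocus T ((counit (R := k) (A := H)).smulRight a) from fun x hx ↦ this hx
    refine GroupLike.spanPowers_le fun n ↦ ?_
    have h1 : ∀ n : ℕ, (g : H) ^ n * a = a := fun n ↦ by
      induction n with
      | zero => rw [pow_zero, one_mul]
      | succ n ih =>
        rw [pow_succ, mul_assoc, show (g : H) * a = a by
          rw [ha, mul_add, mul_add, mul_one, ← mul_assoc, hg3]; abel, ih]
    have h2 : S2 ((g ^ n : GroupLike k H) : H) = (g ^ n : GroupLike k H) :=
      (g ^ n).2.antipode_antipode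
    change S2 ((g ^ n : GroupLike k H) : H) * a = _
    rw [h2, LinearMap.smulRight_apply, (g ^ n).2.1, one_smul, GroupLike.val_pow, h1]
  have hTK' : ∀ x ∈ g.spanPowers, T x ∈ g.spanPowers := fun x hx ↦ by
    rw [hTK x hx]
    exact Submodule.smul_mem _ _ haK
  let P : End k H := C.projection g.spanPowers hcompl
  let Q : End k H := g.spanPowers.projection C hcompl.symm
  have hP : LinearMap.IsProj C P :=
    ⟨Submodule.projection_apply_mem hcompl,
      fun x hx ↦ Submodule.projection_apply_left hcompl ⟨x, hx⟩⟩
  have hQ : LinearMap.IsProj g.spanPowers Q :=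
    ⟨Submodule.projection_apply_mem hcompl.symm,
      fun x hx ↦ Submodule.projection_apply_left hcompl.symm ⟨x, hx⟩⟩
  have hPQ : P + Q = 1 := Submodule.projection_add_projection_eq_id hcompl
  have htrK : LinearMap.trace k H (Q * T) = 3 := by
    rw [← LinearMap.trace_restrict_eq_trace_mul hQ hTK']
    have : T.restrict hTK' = ((counit (R := k)) ∘ₗ g.spanPowers.subtype).smulRight ⟨a, haK⟩ := by
      ext x
      exact hTK x x.2
    rw [this, LinearMap.trace_smulRight]
    simp only [LinearMap.comp_apply, Submodule.subtype_apply, ha, map_add,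
      Bialgebra.counit_one, Bialgebra.counit_mul, g.2.1]
    norm_num
  have hΔ : ∀ x, comul (R := k) (S2 x) = TensorProduct.map S2 S2 (comul x) :=
    comul_antipode_antipode
  have hε : ∀ x, counit (R := k) (S2 x) = counit (R := k) x := fun x ↦ by
    simp [hS2]
  have htrC : LinearMap.trace k H (P * T) = 0 ∨
      LinearMap.trace k H (P * T) = 9 := by
    by_cases hX : C ⊓ C.map S2 = ⊥
    · left
      have hle : C.map S2 ≤ g.spanPowers :=
        (hC.1.map hΔ).le_right_of_le_sup hC.1 g.isSubcoalgebraOf_spanPowers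
          (hsup ▸ le_top) (by rw [inf_comm, hX])
      suffices P * T = 0 by rw [this, map_zero]
      refine LinearMap.ext fun x ↦ ?_
      have hx : x ∈ C ⊔ g.spanPowers := hsup ▸ Submodule.mem_top
      obtain ⟨c, hc, y, hy, rfl⟩ := Submodule.mem_sup.mp hx
      refine (Submodule.projection_apply_eq_zero_iff hcompl).mpr ?_
      rw [map_add]
      exact add_mem (hKmul _ (hle (Submodule.mem_map_of_mem hc))) (hTK' y hy)
    · have hle := hC.le_of_inf_ne_bot (hC.1.map hΔ) hX
      have heq : C = C.map S2 :=
        Submodule.eq_of_le_of_finrank_le hle (Submodule.finrank_map_le _ _)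
      have hS2C : ∀ c ∈ C, S2 c ∈ C := fun c hc ↦ heq ▸ Submodule.mem_map_of_mem hc
      have hTC : ∀ c ∈ C, T c ∈ C := fun c hc ↦ by
        have h0 := hS2C c hc
        have h1 := hmaps _ h0
        have h2 := hmaps _ h1
        change S2 c * a ∈ C
        rw [ha, mul_add, mul_add, mul_one, ← mul_assoc]
        exact add_mem (add_mem h0 h1) h2
      rw [← LinearMap.trace_restrict_eq_trace_mul hP hTC]
      let := hC.1.coalgebra
      have := hC.isSimpleRing_dual
      let φ := hC.1.restrictHom hS2C hε hΔ
      let ρ := hC.1.restrictHom hmaps (fun x ↦ by simp [hR, g.2.1]) g.comul_mulRight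
      have hφ : Function.Injective φ := by
        refine LinearMap.injective_iff_surjective.mpr fun c ↦ ?_
        obtain ⟨y, hy, hyc⟩ := heq.le c.2
        exact ⟨⟨y, hy⟩, Subtype.ext hyc⟩
      refine Coalgebra.trace_average_comp_eq_zero_or_nine h9 (φ := φ) (ρ := ρ) hφ
        (fun x ↦ Subtype.ext ?_) (fun x ↦ Subtype.ext ?_) ?_ ?_ fun x ↦ Subtype.ext ?_
      · change (x : H) * g * g * g = x
        rw [mul_assoc, mul_assoc, ← mul_assoc (g : H), hg3, mul_one]
      · change S2 ((x : H) * g) = S2 x * g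
        conv_rhs => rw [← hS2g]
        simp [hS2, antipode_mul_antidistrib]
      · exact hC.1.trace_restrict_mulRight_eq_zero (hg ▸ Nat.prime_three) hmaps
      · have hg2 : orderOf (g ^ 2) = 3 := by
          rw [Nat.Coprime.orderOf_pow (by rw [hg]; decide), hg]
        have h2 : ∀ x : H, x * ((g ^ 2 : GroupLike k H) : H) = x * g * g := fun x ↦ by
          rw [GroupLike.val_pow, pow_two, mul_assoc]
        have hmaps2 : ∀ c ∈ C, LinearMap.mulRight k ((g ^ 2 : GroupLike k H) : H) c ∈ C :=
          fun c hc ↦ by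
            rw [LinearMap.mulRight_apply, h2]
            exact hmaps _ (hmaps c hc)
        rw [← hC.1.trace_restrict_mulRight_eq_zero (hg2 ▸ Nat.prime_three) hmaps2]
        congr 1
        exact LinearMap.ext fun x ↦ Subtype.ext (h2 x).symm
      · change S2 x * a = S2 x + S2 x * g + S2 x * g * g
        rw [ha, mul_add, mul_add, mul_one, ← mul_assoc]
  rw [← one_mul T, ← hPQ, add_mul, map_add, htrK]
  rcases htrC with h | h <;> rw [h] <;> norm_num

end SimpleSubcoalgebras

/-- if `H` is a non-semisimple Hopf algebra of dimension `4p` (`p` an odd prime)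
over an algebraically closed field of characteristic zero and `p` divides the order of the
group of group-like elements of `H`, then `H` is pointed. -/
theorem nonsemisimple_dim_4p_pointed_of_dvd_card_groupLike
    (k : Type) [Field k] [IsAlgClosed k] [CharZero k]
    (p : ℕ) (hp : p.Prime) (hodd : Odd p)
    (H : Type) [Ring H] [HopfAlgebra k H]
    (hdim : Module.finrank k H = 4 * p)
    (hns : ¬ IsSemisimpleRing H)
    (hdvd : p ∣ Nat.card {a : H // IsGroupLikeOf (Coalgebra.comul (R := k) (A := H)) a}) :
    IsPointedOf (Coalgebra.comul (R := k) (A := H)) := by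
  have : FiniteDimensional k H :=
    Module.finite_of_finrank_pos (by rw [hdim]; exact Nat.mul_pos four_pos hp.pos)
  obtain ⟨g, rfl⟩ := GroupLike.exists_orderOf_eq hp hdvd
  intro C hC
  by_contra h1
  obtain ⟨h3, h9, hmaps⟩ := hC.finrank_eq_nine h1 hp hodd hdim
  exact hns (hC.isSemisimpleRing h9 h3 (by rw [hdim, h3]) hmaps)
end
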